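/- arXiv:1707.04252 — 2 statements merged into one kernel-verified Lean document; each statement's English description precedes it below -/
import Mathlib

section
/- Let n ≥ 1, k ≥ 1 an integer, T > 0, κ > 0. Let a = (a_1,…,a_n) and b be smooth functions on ℝⁿ × [0,T] whose partial derivatives with respect to the space variables x up to order k are bounded, and with Σ_{i=1}^n sup_{(x,t)} |a_i(x,t)| ≤ 1/κ. Let u be a sufficiently smooth (C^{k+1}) solution of u_t + Σ_{i=1}^n a_i(x,t) u_{x_i} + b(x,t) u = f(x,t) on ℝⁿ × [0,T] with u(x,0) = u₀(x), such that ∂^α_x u(t,·) ∈ L²(ℝⁿ) for all |α| ≤ k and all t ∈ [0,T]. If u₀ ∈ H^k(ℝⁿ) and f is continuous in t with f(t,·) ∈ H^k(ℝⁿ) for each t, then there exist positive constants δ₀ and C₀ (depending only on the bounds on the derivatives of a and b, and on T) such that for all t ∈ [0,T]: e^{−δ₀ t} ‖u(t,·)‖²_{H^k(ℝⁿ)} ≤ ‖u₀‖²_{H^k(ℝⁿ)} + C₀ ∫₀ᵗ e^{−δ₀ s} ‖f(s,·)‖²_{H^k(ℝⁿ)} ds. -/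
open MeasureTheory Real Set

noncomputable section

/-- Membership in the Sobolev space `H^k(ℝⁿ)` (classical derivatives). -/
def MemHk (n k : ℕ) (g : EuclideanSpace ℝ (Fin n) → ℝ) : Prop :=
  ∀ m : ℕ, m ≤ k →
    Integrable (fun x : EuclideanSpace ℝ (Fin n) => ‖iteratedFDeriv ℝ m g x‖ ^ 2)

/-- The squared `H^k(ℝⁿ)` norm. -/
noncomputable def HkNormSq (n k : ℕ) (g : EuclideanSpace ℝ (Fin n) → ℝ) : ℝ :=
  ∑ m ∈ Finset.range (k + 1), ∫ x : EuclideanSpace ℝ (Fin n), ‖iteratedFDeriv ℝ m g x‖ ^ 2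

open Filter Topology

section Calculus

variable {E F : Type*} [NormedAddCommGroup E] [NormedSpace ℝ E]
  [NormedAddCommGroup F] [NormedSpace ℝ F]

/-- A directional derivative commutes with the iterated Fréchet derivative. -/
theorem fderiv_iteratedFDeriv_apply {U : E → F} (e : E) (m : ℕ) {p : E}
    (hU : ContDiffAt ℝ (m + 1) U p) :
    fderiv ℝ (iteratedFDeriv ℝ m U) p e = iteratedFDeriv ℝ m (fun q => fderiv ℝ U q e) p := by
  induction m generalizing p with
  | zero =>
    ext v
    rw [iteratedFDeriv_zero_apply, iteratedFDeriv_zero_eq_comp]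
    rw [LinearIsometryEquiv.comp_fderiv]
    simp
  | succ m ih =>
    ext v
    have hW : ContDiffAt ℝ 2 (iteratedFDeriv ℝ m U) p :=
      hU.iteratedFDeriv_right (by push_cast; rw [add_comm, add_assoc]; norm_num)
    have hev : (fun q => fderiv ℝ (iteratedFDeriv ℝ m U) q e)
        =ᶠ[𝓝 p] iteratedFDeriv ℝ m (fun q => fderiv ℝ U q e) := by
      filter_upwards [hU.eventually (by norm_cast; exact WithTop.coe_ne_top)] with q hq
      exact ih (hq.of_le (by push_cast; exact le_self_add))
    have hd : DifferentiableAt ℝ (fderiv ℝ (iteratedFDeriv ℝ m U)) p :=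
      (hW.fderiv_right (m := 1) (by norm_num)).differentiableAt (by norm_num)
    have hsymm : IsSymmSndFDerivAt ℝ (iteratedFDeriv ℝ m U) p :=
      hW.isSymmSndFDerivAt (by simp)
    rw [iteratedFDeriv_succ_eq_comp_left]
    let J : (E →L[ℝ] E [×m]→L[ℝ] F) ≃ₗᵢ[ℝ] (E [×(m + 1)]→L[ℝ] F) :=
      (continuousMultilinearCurryLeftEquiv ℝ (fun _ : Fin (m + 1) => E) F).symm
    have hc := LinearIsometryEquiv.comp_fderiv (𝕜 := ℝ) (F := E [×(m + 1)]→L[ℝ] F) J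
      (f := fderiv ℝ (iteratedFDeriv ℝ m U)) (x := p)
    refine (congrArg (fun L => L e v) hc).trans ?_
    rw [iteratedFDeriv_succ_apply_left, ← hev.fderiv_eq,
      fderiv_clm_apply hd (differentiableAt_const e)]
    simp only [ContinuousLinearMap.comp_apply, ContinuousLinearEquiv.coe_coe,
      LinearIsometryEquiv.coe_toContinuousLinearEquiv]
    change (fderiv ℝ (fderiv ℝ (iteratedFDeriv ℝ m U)) p e (v 0)) (Fin.tail v) = _
    rw [hsymm.eq e (v 0)]
    simp

open scoped Pointwise in
/-- Iterated derivatives of a time slice, in terms of those of the function on space-time. -/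
theorem iteratedFDeriv_slice {U : E × ℝ → F} {I : Set ℝ} (hI : UniqueDiffOn ℝ I) {N : ℕ}
    (hU : ContDiffOn ℝ N U (univ ×ˢ I)) {m : ℕ} (hm : m ≤ N) {t : ℝ} (ht : t ∈ I) (x : E) :
    iteratedFDeriv ℝ m (fun y => U (y, t)) x
      = (iteratedFDerivWithin ℝ m U (univ ×ˢ I) (x, t)).compContinuousLinearMap
          (fun _ => ContinuousLinearMap.inl ℝ E ℝ) := by
  have hS : UniqueDiffOn ℝ ((univ : Set E) ×ˢ I) := uniqueDiffOn_univ.prod hI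
  set S : Set (E × ℝ) := univ ×ˢ I
  set S' : Set (E × ℝ) := univ ×ˢ ((fun s => s + t) ⁻¹' I)
  have hvadd : ((0, t) : E × ℝ) +ᵥ S' = S := by
    ext ⟨y, s⟩
    rw [Set.mem_vadd_set_iff_neg_vadd_mem]
    simp [S, S']
  have hS' : UniqueDiffOn ℝ S' := by
    refine uniqueDiffOn_univ.prod ?_
    have hshift : (fun s => s + t) ⁻¹' I = (fun s => s + -t) '' I := by
      rw [Set.image_add_right, neg_neg]
    rw [hshift]
    refine hI.image (f' := fun _ => ContinuousLinearMap.id ℝ ℝ)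
      (fun s _ => ((hasFDerivAt_id s).add_const (-t)).hasFDerivWithinAt) fun _ _ => ?_
    exact Function.surjective_id.denseRange
  have hU' : ContDiffOn ℝ N (fun z => U (z + (0, t))) S' := by
    refine hU.comp (by fun_prop) ?_
    rintro ⟨y, s⟩ h
    simpa [S, S'] using h
  have hpre : (ContinuousLinearMap.inl ℝ E ℝ) ⁻¹' S' = univ := by
    ext y
    simp [S', ht]
  have key := (ContinuousLinearMap.inl ℝ E ℝ).iteratedFDerivWithin_comp_right hU' hS'
    (by rw [hpre]; exact uniqueDiffOn_univ) (x := x) (by simp [S', ht]) (i := m)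
    (by exact_mod_cast hm)
  rw [hpre, iteratedFDerivWithin_univ, iteratedFDerivWithin_comp_add_right, hvadd] at key
  simpa [Function.comp_def] using key

/-- First order expansion along a vector field, uniform on compact sets. -/
theorem eventually_norm_sub_le_of_isCompact {V : E × ℝ → F} {T t₀ : ℝ} (ht₀ : t₀ ∈ Ioo 0 T)
    (hV : ContDiffOn ℝ 1 V (univ ×ˢ Ioo 0 T)) {α : E → E} (hα : Continuous α)
    {K : Set E} (hK : IsCompact K) {ε : ℝ} (hε : 0 < ε) :
    ∀ᶠ h in 𝓝[>] (0 : ℝ), ∀ x ∈ K,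
      ‖V (x + h • α x, t₀ + h) - V (x, t₀) - h • fderiv ℝ V (x, t₀) (α x, 1)‖ ≤ ε * h := by
  have hopen : IsOpen ((univ : Set E) ×ˢ Ioo (0 : ℝ) T) := isOpen_univ.prod isOpen_Ioo
  set Q : ℝ × E → F := fun z => fderiv ℝ V (z.2 + z.1 • α z.2, t₀ + z.1) (α z.2, 1) with hQ
  have hQc : ∀ x, ContinuousAt Q (0, x) := by
    intro x
    have h1 : ContinuousAt (fderiv ℝ V) (x + (0 : ℝ) • α x, t₀ + 0) :=
      (hV.continuousOn_fderiv_of_isOpen hopen le_rfl).continuousAt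
        (hopen.mem_nhds (by simpa using ht₀))
    have h2 : ContinuousAt (fun z : ℝ × E => (z.2 + z.1 • α z.2, t₀ + z.1)) (0, x) := by
      fun_prop
    exact (ContinuousAt.comp (f := fun z : ℝ × E => (z.2 + z.1 • α z.2, t₀ + z.1)) h1 h2).clm_apply
      (by fun_prop)
  have hev : ∀ᶠ s in 𝓝 (0 : ℝ), ∀ x ∈ K, ‖Q (s, x) - Q (0, x)‖ ≤ ε := by
    refine hK.eventually_forall_of_forall_eventually
      (P := fun s x => ‖Q (s, x) - Q (0, x)‖ ≤ ε) fun x _ => ?_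
    have h1 : ContinuousAt (fun z : ℝ × E => ‖Q z - Q (0, z.2)‖) (0, x) := by
      refine ((hQc x).sub ?_).norm
      exact ContinuousAt.comp (f := fun z : ℝ × E => ((0 : ℝ), z.2)) (x := (0, x)) (hQc x)
        (by fun_prop)
    exact h1.eventually (Iic_mem_nhds (by simpa using hε))
  have hev2 : ∀ᶠ s in 𝓝 (0 : ℝ), t₀ + s ∈ Ioo 0 T :=
    (continuous_const.add continuous_id).continuousAt.eventually
      (isOpen_Ioo.mem_nhds (by simpa using ht₀))
  obtain ⟨δ, hδ, hball⟩ := Metric.eventually_nhds_iff.1 (hev.and hev2)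
  filter_upwards [Ioo_mem_nhdsGT hδ] with h hh x hx
  have hd : ∀ s ∈ Icc 0 h, HasDerivWithinAt
      (fun s => V (x + s • α x, t₀ + s) - s • Q (0, x)) (Q (s, x) - Q (0, x)) (Icc 0 h) s := by
    intro s hs
    have hs' : t₀ + s ∈ Ioo 0 T := by
      refine (hball ?_).2
      rw [Real.dist_eq, sub_zero, abs_of_nonneg hs.1]
      exact hs.2.trans_lt hh.2
    have hVd : HasFDerivAt V (fderiv ℝ V (x + s • α x, t₀ + s)) (x + s • α x, t₀ + s) :=
      ((hV.contDiffAt (hopen.mem_nhds ⟨mem_univ _, hs'⟩)).differentiableAt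
        (by norm_num)).hasFDerivAt
    have hpath : HasDerivAt (fun s : ℝ => (x + s • α x, t₀ + s)) (α x, 1) s := by
      have h1 : HasDerivAt (fun s : ℝ => x + s • α x) (α x) s := by
        simpa using ((hasDerivAt_id s).smul_const (α x)).const_add x
      exact h1.prodMk ((hasDerivAt_id s).const_add t₀)
    have h2 : HasDerivAt (fun s : ℝ => s • Q (0, x)) (Q (0, x)) s := by
      simpa using (hasDerivAt_id s).smul_const (Q (0, x))
    exact ((hVd.comp_hasDerivAt s hpath).sub h2).hasDerivWithinAt
  have := norm_image_sub_le_of_norm_deriv_le_segment' hd (C := ε) (by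
    intro s hs
    refine (hball ?_).1 x hx
    rw [Real.dist_eq, sub_zero, abs_of_nonneg hs.1]
    exact hs.2.trans hh.2) h ⟨hh.1.le, le_rfl⟩
  simpa [hQ, sub_right_comm] using this

end Calculus

section Analysis

/-- A Grönwall inequality for a function whose upper right Dini derivative is controlled in the
interior of the interval. -/
theorem exp_neg_mul_le_of_eventually_slope_lt {y φ : ℝ → ℝ} {δ C T : ℝ}
    (hy : ContinuousOn y (Icc 0 T)) (hφ : ContinuousOn φ (Icc 0 T))
    (hslope : ∀ t ∈ Ioo 0 T, ∀ r, δ * y t + C * φ t < r → ∀ᶠ z in 𝓝[>] t, slope y t z < r)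
    {t : ℝ} (ht : t ∈ Icc 0 T) :
    Real.exp (-δ * t) * y t ≤ y 0 + C * ∫ s in (0 : ℝ)..t, Real.exp (-δ * s) * φ s := by
  have hT : 0 ≤ T := ht.1.trans ht.2
  set ψ : ℝ → ℝ := IccExtend hT ((Icc 0 T).domRestrict φ) with hψ
  have hψc : Continuous ψ := (continuousOn_iff_continuous_domRestrict.1 hφ).Icc_extend'
  have hψφ : ∀ s ∈ Icc 0 T, ψ s = φ s := fun s hs => by
    rw [hψ, IccExtend_of_mem hT _ hs]
    rfl
  set J : ℝ → ℝ := fun t => ∫ s in (0 : ℝ)..t, Real.exp (-δ * s) * ψ s with hJ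
  have hJd : ∀ t, HasDerivAt J (Real.exp (-δ * t) * ψ t) t := fun t =>
    (by fun_prop : Continuous fun s => Real.exp (-δ * s) * ψ s).integral_hasStrictDerivAt 0 t
      |>.hasDerivAt
  have hJeq : ∫ s in (0 : ℝ)..t, Real.exp (-δ * s) * φ s = J t := by
    refine intervalIntegral.integral_congr fun s hs => ?_
    rw [uIcc_of_le ht.1] at hs
    simp only [hψφ s ⟨hs.1, hs.2.trans ht.2⟩]
  have hstep : ∀ s ∈ Ioc 0 t, Real.exp (-δ * t) * y t
      ≤ Real.exp (-δ * s) * y s - C * J s + C * J t := by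
    intro s hs
    refine le_of_forall_pos_le_add fun η hη => ?_
    set η' := η / (t + 1) with hη'
    have hη'pos : 0 < η' := div_pos hη (by linarith [ht.1])
    set B : ℝ → ℝ := fun z => Real.exp (δ * z) *
      (Real.exp (-δ * s) * y s - C * J s + C * J z + η' * (z - s)) with hB
    have hBd : ∀ z, HasDerivAt B (δ * B z + C * ψ z + Real.exp (δ * z) * η') z := by
      intro z
      have h1 : HasDerivAt (fun z => Real.exp (δ * z)) (Real.exp (δ * z) * (δ * 1)) z :=
        ((hasDerivAt_id z).const_mul δ).exp
      have h2 := (((hJd z).const_mul C).const_add (Real.exp (-δ * s) * y s - C * J s)).add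
        (((hasDerivAt_id z).sub_const s).const_mul η')
      refine (h1.mul h2).congr_deriv ?_
      have h3 : Real.exp (δ * z) * Real.exp (-δ * z) = 1 := by rw [← Real.exp_add]; simp
      simp only [hB, Pi.add_apply, id]
      linear_combination (C * ψ z) * h3
    have hmain := image_le_of_liminf_slope_right_lt_deriv_boundary
      (f := y) (f' := fun z => δ * y z + C * ψ z) (a := s) (b := t)
      (hy.mono (Icc_subset_Icc hs.1.le ht.2))
      (fun z hz r hr => by
        have hz' : z ∈ Ioo 0 T := ⟨hs.1.trans_le hz.1, hz.2.trans_le ht.2⟩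
        exact (hslope z hz' r (by rwa [← hψφ z ⟨hz'.1.le, hz'.2.le⟩])).frequently)
      (B := B) (by
        have h3 : Real.exp (δ * s) * Real.exp (-δ * s) = 1 := by rw [← Real.exp_add]; simp
        simp only [hB]
        apply le_of_eq
        linear_combination (-y s) * h3) hBd
      (fun z _ hzB => by
        rw [hzB]
        have := mul_pos (Real.exp_pos (δ * z)) hη'pos
        linarith) (⟨hs.2, le_rfl⟩ : t ∈ Icc s t)
    have h3 : Real.exp (-δ * t) * Real.exp (δ * t) = 1 := by rw [← Real.exp_add]; simp
    calc Real.exp (-δ * t) * y t ≤ Real.exp (-δ * t) * B t :=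
          mul_le_mul_of_nonneg_left hmain (Real.exp_pos _).le
      _ = Real.exp (-δ * s) * y s - C * J s + C * J t + η' * (t - s) := by
          simp only [hB]
          linear_combination
            (Real.exp (-δ * s) * y s - C * J s + C * J t + η' * (t - s)) * h3
      _ ≤ _ := by
          have : η' * (t - s) ≤ η := by
            rw [hη', div_mul_eq_mul_div, div_le_iff₀ (by linarith [ht.1])]
            nlinarith [hs.1]
          linarith
  rw [hJeq]
  rcases ht.1.eq_or_lt with h0 | h0
  · simp [← h0, hJ]
  have hlim : Tendsto (fun s => Real.exp (-δ * s) * y s - C * J s + C * J t) (𝓝[Ioc 0 t] 0)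
      (𝓝 (Real.exp (-δ * 0) * y 0 - C * J 0 + C * J t)) := by
    have hy0 : Tendsto y (𝓝[Ioc 0 t] 0) (𝓝 (y 0)) :=
      (hy 0 ⟨le_rfl, hT⟩).mono_left (nhdsWithin_mono _ fun s hs => ⟨hs.1.le, hs.2.trans ht.2⟩)
    have hJ0 : Tendsto J (𝓝[Ioc 0 t] 0) (𝓝 (J 0)) :=
      (hJd 0).continuousAt.tendsto.mono_left nhdsWithin_le_nhds
    have he : Tendsto (fun s => Real.exp (-δ * s)) (𝓝[Ioc 0 t] 0) (𝓝 (Real.exp (-δ * 0))) :=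
      (by fun_prop : Continuous fun s => Real.exp (-δ * s)).continuousAt.tendsto.mono_left
        nhdsWithin_le_nhds
    exact ((he.mul hy0).sub (hJ0.const_mul C)).add_const _
  have : (𝓝[Ioc 0 t] (0 : ℝ)).NeBot := by
    rw [nhdsWithin_Ioc_eq_nhdsGT h0]
    infer_instance
  have := ge_of_tendsto hlim (eventually_of_mem self_mem_nhdsWithin hstep)
  simpa [hJ] using this

section Weight

variable {E : Type*} [NormedAddCommGroup E]

/-- A weight supported in the backward cone of slope `c` over the ball of radius `R`. -/
def coneWeight (E : Type*) [NormedAddCommGroup E] (c R : ℝ) (x : E) (t : ℝ) : ℝ :=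
  max 0 (1 - (‖x‖ + c * t) / R)

theorem coneWeight_nonneg (c R : ℝ) (x : E) (t : ℝ) : 0 ≤ coneWeight E c R x t :=
  le_max_left _ _

theorem coneWeight_le_one {c R : ℝ} (hc : 0 ≤ c) (hR : 0 ≤ R) (x : E) {t : ℝ} (ht : 0 ≤ t) :
    coneWeight E c R x t ≤ 1 :=
  max_le zero_le_one (sub_le_self _ (by positivity))

theorem continuous_coneWeight (c R : ℝ) :
    Continuous fun p : E × ℝ => coneWeight E c R p.1 p.2 := by
  unfold coneWeight
  fun_prop

theorem coneWeight_eq_zero {c R : ℝ} (hc : 0 ≤ c) (hR : 0 < R) {x : E} {t : ℝ} (ht : 0 ≤ t)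
    (hx : x ∉ Metric.closedBall 0 R) : coneWeight E c R x t = 0 := by
  rw [mem_closedBall_zero_iff, not_le] at hx
  refine max_eq_left (sub_nonpos.2 ((one_le_div hR).2 ?_))
  nlinarith [mul_nonneg hc ht]

theorem tendsto_coneWeight (c : ℝ) (x : E) (t : ℝ) :
    Tendsto (fun N : ℕ => coneWeight E c ((N : ℝ) + 1) x t) atTop (𝓝 1) := by
  have h1 : Tendsto (fun N : ℕ => (N : ℝ) + 1) atTop atTop :=
    tendsto_atTop_add_const_right _ _ tendsto_natCast_atTop_atTop
  have h2 := (tendsto_const_nhds (x := (1 : ℝ))).sub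
    ((tendsto_const_nhds (x := ‖x‖ + c * t)).div_atTop h1)
  have h3 := (tendsto_const_nhds (x := (0 : ℝ))).max h2
  simpa [coneWeight] using h3

theorem continuousOn_integral_coneWeight_mul [ProperSpace E] [MeasurableSpace E] [BorelSpace E]
    (μ : Measure E) [IsFiniteMeasureOnCompacts μ] {c R T : ℝ} (hc : 0 ≤ c) (hR : 0 < R)
    {G : E → ℝ → ℝ} (hG : ContinuousOn (fun p : E × ℝ => G p.1 p.2) (univ ×ˢ Icc 0 T)) :
    ContinuousOn (fun t => ∫ x, coneWeight E c R x t * G x t ∂μ) (Icc 0 T) := by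
  refine continuousOn_integral_of_compact_support (f := fun t x => coneWeight E c R x t * G x t)
    (isCompact_closedBall (0 : E) R) ?_ ?_
  · have hswap : MapsTo Prod.swap (Icc 0 T ×ˢ (univ : Set E)) (univ ×ˢ Icc 0 T) :=
      fun p hp => ⟨hp.2, hp.1⟩
    exact ((continuous_coneWeight c R).comp continuous_swap).continuousOn.mul
      (hG.comp continuous_swap.continuousOn hswap)
  · intro t x ht hx
    rw [coneWeight_eq_zero hc hR ht.1 hx, zero_mul]

theorem tendsto_integral_coneWeight_mul [MeasurableSpace E] [BorelSpace E]
    [SecondCountableTopology E] (μ : Measure E) {c t : ℝ} (hc : 0 ≤ c) (ht : 0 ≤ t)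
    {g : E → ℝ} (hg : Integrable g μ) :
    Tendsto (fun N : ℕ => ∫ x, coneWeight E c ((N : ℝ) + 1) x t * g x ∂μ) atTop
      (𝓝 (∫ x, g x ∂μ)) := by
  refine tendsto_integral_of_dominated_convergence (fun x => ‖g x‖) (fun N => ?_) hg.norm
    (fun N => Eventually.of_forall fun x => ?_) (Eventually.of_forall fun x => ?_)
  · have hcont : Continuous fun x : E => coneWeight E c ((N : ℝ) + 1) x t :=
      (continuous_coneWeight c _).comp (by fun_prop : Continuous fun x : E => (x, t))
    exact hcont.aestronglyMeasurable.mul hg.aestronglyMeasurable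
  · rw [norm_mul, Real.norm_of_nonneg (coneWeight_nonneg _ _ _ _)]
    exact mul_le_of_le_one_left (norm_nonneg _)
      (coneWeight_le_one hc (by positivity) x ht)
  · simpa using (tendsto_coneWeight c x t).mul_const (g x)

theorem integrable_coneWeight_mul [MeasurableSpace E] [BorelSpace E] [SecondCountableTopology E]
    (μ : Measure E) {c R t : ℝ} (hc : 0 ≤ c) (hR : 0 < R)
    (ht : 0 ≤ t) {g : E → ℝ} (hg : Integrable g μ) :
    Integrable (fun x => coneWeight E c R x t * g x) μ := by
  have hcont : Continuous fun x : E => coneWeight E c R x t :=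
    (continuous_coneWeight c _).comp (by fun_prop : Continuous fun x : E => (x, t))
  refine hg.mono (hcont.aestronglyMeasurable.mul hg.aestronglyMeasurable)
    (Eventually.of_forall fun x => ?_)
  rw [norm_mul, Real.norm_of_nonneg (coneWeight_nonneg _ _ _ _)]
  exact mul_le_of_le_one_left (norm_nonneg _) (coneWeight_le_one hc hR.le x ht)

theorem coneWeight_add_smul_le [NormedSpace ℝ E] {c R : ℝ} (hR : 0 < R) {x v : E}
    (hv : ‖v‖ ≤ c) (t : ℝ) {h : ℝ} (hh : 0 ≤ h) :
    coneWeight E c R (x + h • v) (t + h) ≤ coneWeight E c R x t := by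
  refine max_le_max le_rfl (sub_le_sub_left (div_le_div_of_nonneg_right ?_ hR.le) 1)
  have h1 : ‖x‖ ≤ ‖x + h • v‖ + ‖h • v‖ := by
    simpa using norm_sub_le (x + h • v) (h • v)
  rw [norm_smul, Real.norm_of_nonneg hh] at h1
  nlinarith [mul_le_mul_of_nonneg_left hv hh]

end Weight

variable {E : Type*} [NormedAddCommGroup E] [NormedSpace ℝ E] [FiniteDimensional ℝ E]
  [MeasurableSpace E] [BorelSpace E]

theorem ContinuousLinearMap.abs_det_le_norm_pow (A : E →L[ℝ] E) :
    |A.det| ≤ ‖A‖ ^ Module.finrank ℝ E := by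
  let μ : Measure E := Measure.addHaar
  have hpos : 0 < μ (Metric.closedBall 0 1) := Metric.measure_closedBall_pos μ 0 one_pos
  have hfin : μ (Metric.closedBall 0 1) ≠ ⊤ := measure_closedBall_lt_top.ne
  have himage : A '' Metric.closedBall 0 1 ⊆ Metric.closedBall 0 ‖A‖ := by
    rintro _ ⟨x, hx, rfl⟩
    rw [mem_closedBall_zero_iff] at hx ⊢
    exact (A.le_opNorm x).trans (mul_le_of_le_one_right (norm_nonneg A) hx)
  have h := measure_mono (μ := μ) himage
  rw [Measure.addHaar_image_continuousLinearMap, Measure.addHaar_closedBall' μ 0 (norm_nonneg A),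
    ENNReal.mul_le_mul_iff_left hpos.ne' hfin] at h
  exact (ENNReal.ofReal_le_ofReal_iff (by positivity)).1 h

/-- Integrals after transporting the space by `x ↦ x + h α(x)`. -/
theorem integral_le_of_comp_add_smul_le (μ : Measure E) [μ.IsAddHaarMeasure] {α : E → E}
    (hα : Differentiable ℝ α) {M h : ℝ} (hM : 0 ≤ M) (hαM : ∀ x, ‖fderiv ℝ α x‖ ≤ M)
    (h0 : 0 ≤ h) (hhM : h * M < 1) {g H : E → ℝ} (hg : ∀ x, 0 ≤ g x) (hH : Integrable H μ)
    (hgH : ∀ x, g (x + h • α x) ≤ H x) :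
    ∫ x, g x ∂μ ≤ (1 + h * M) ^ Module.finrank ℝ E * ∫ x, H x ∂μ := by
  set Φ : E → E := fun x => x + h • α x with hΦ
  have hd : ∀ x, HasFDerivAt Φ (ContinuousLinearMap.id ℝ E + h • fderiv ℝ α x) x := fun x =>
    (hasFDerivAt_id x).add ((hα x).hasFDerivAt.const_smul h)
  have hLip : LipschitzWith (M.toNNReal) α :=
    lipschitzWith_of_nnnorm_fderiv_le hα fun x => by
      rw [← NNReal.coe_le_coe, Real.coe_toNNReal _ hM]
      exact hαM x
  have happ : ApproximatesLinearOn Φ ((ContinuousLinearEquiv.refl ℝ E : E ≃L[ℝ] E) : E →L[ℝ] E)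
      univ (h * M).toNNReal := by
    rw [ApproximatesLinearOn.approximatesLinearOn_iff_lipschitzOnWith, lipschitzOnWith_univ]
    refine LipschitzWith.of_dist_le_mul fun x y => ?_
    have := hLip.dist_le_mul x y
    rw [Real.coe_toNNReal _ hM] at this
    rw [Real.coe_toNNReal _ (mul_nonneg h0 hM)]
    simp only [hΦ, Pi.sub_apply, ContinuousLinearEquiv.coe_coe, ContinuousLinearEquiv.refl_apply,
      add_sub_cancel_left]
    rw [dist_smul₀, Real.norm_of_nonneg h0, mul_assoc]
    gcongr
  have hc : Subsingleton E ∨ (h * M).toNNReal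
      < ‖((ContinuousLinearEquiv.refl ℝ E).symm : E →L[ℝ] E)‖₊⁻¹ := by
    rcases subsingleton_or_nontrivial E with hE | hE
    · exact Or.inl hE
    · right
      rw [← NNReal.coe_lt_coe, Real.coe_toNNReal _ (mul_nonneg h0 hM)]
      simpa using hhM
  have hinj : InjOn Φ univ := happ.injOn hc
  have himg : Φ '' univ = univ := by rw [image_univ]; exact (happ.surjective hc).range_eq
  have hcv := integral_image_eq_integral_abs_det_fderiv_smul μ MeasurableSet.univ
    (fun x _ => (hd x).hasFDerivWithinAt) hinj g
  rw [himg, Measure.restrict_univ] at hcv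
  rw [hcv, ← integral_const_mul]
  refine integral_mono_of_nonneg (Eventually.of_forall fun x => ?_) (hH.const_mul _)
    (Eventually.of_forall fun x => ?_)
  · exact mul_nonneg (abs_nonneg _) (hg _)
  · have hH0 : 0 ≤ H x := (hg _).trans (hgH x)
    refine mul_le_mul ?_ (hgH x) (hg _) (by positivity)
    refine (ContinuousLinearMap.abs_det_le_norm_pow _).trans ?_
    gcongr
    refine (norm_add_le _ _).trans (add_le_add ContinuousLinearMap.norm_id_le ?_)
    rw [norm_smul, Real.norm_of_nonneg h0]
    exact mul_le_mul_of_nonneg_left (hαM x) h0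

theorem integrable_coneWeight (μ : Measure E) [IsFiniteMeasureOnCompacts μ] {c R : ℝ}
    (hc : 0 ≤ c) (hR : 0 < R) {t : ℝ} (ht : 0 ≤ t) :
    Integrable (fun x : E => coneWeight E c R x t) μ := by
  have hcont : Continuous fun x : E => coneWeight E c R x t :=
    (continuous_coneWeight c R).comp (by fun_prop : Continuous fun x : E => (x, t))
  refine hcont.integrable_of_hasCompactSupport ?_
  exact HasCompactSupport.intro (isCompact_closedBall (0 : E) R)
    fun x hx => coneWeight_eq_zero hc hR ht hx

/-- A pointwise one-step inequality along the characteristics bounds the Dini derivative of the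
localized energy. -/
theorem eventually_slope_integral_coneWeight_lt (μ : Measure E) [μ.IsAddHaarMeasure]
    {α : E → E} (hα : Differentiable ℝ α) {M c R t₀ C₁ C₂ : ℝ} (hM : 0 ≤ M)
    (hαM : ∀ x, ‖fderiv ℝ α x‖ ≤ M) (hαc : ∀ x, ‖α x‖ ≤ c) (hR : 0 < R) (ht₀ : 0 ≤ t₀)
    (hC₂ : 0 ≤ C₂)
    {G : E → ℝ → ℝ} {f : E → ℝ} (hG : ∀ x t, 0 ≤ G x t) (hf : ∀ x, 0 ≤ f x)
    (hGi : Integrable (fun x => G x t₀) μ) (hfi : Integrable f μ)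
    (hstep : ∀ ε > 0, ∀ᶠ h in 𝓝[>] (0 : ℝ), ∀ x ∈ Metric.closedBall (0 : E) R,
      G (x + h • α x) (t₀ + h) ≤ (1 + h) * ((1 + C₁ * h) * G x t₀ + C₂ * h * f x + ε * h))
    {r : ℝ} (hr : (Module.finrank ℝ E * M + 1 + C₁) * ∫ x, coneWeight E c R x t₀ * G x t₀ ∂μ
      + C₂ * ∫ x, f x ∂μ < r) :
    ∀ᶠ z in 𝓝[>] t₀, slope (fun t => ∫ x, coneWeight E c R x t * G x t ∂μ) t₀ z < r := by
  have hc : 0 ≤ c := (norm_nonneg _).trans (hαc 0)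
  set d := Module.finrank ℝ E with hd
  set 𝓔 : ℝ → ℝ := fun t => ∫ x, coneWeight E c R x t * G x t ∂μ with h𝓔
  set 𝓕 : ℝ := ∫ x, f x ∂μ with h𝓕
  set ν : ℝ := ∫ x, coneWeight E c R x t₀ ∂μ with hν
  have hν0 : 0 ≤ ν := integral_nonneg fun x => coneWeight_nonneg _ _ _ _
  set gap := r - ((d * M + 1 + C₁) * 𝓔 t₀ + C₂ * 𝓕) with hgap
  have hgap0 : 0 < gap := sub_pos.2 hr
  set ε := gap / (ν + 1) with hε
  have hε0 : 0 < ε := div_pos hgap0 (by linarith)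
  have hεν : ε * ν < gap := by
    rw [hε, div_mul_eq_mul_div, div_lt_iff₀ (by linarith)]
    nlinarith
  set P : ℝ → ℝ := fun h => (1 + h * M) ^ d * ((1 + h) *
    ((1 + C₁ * h) * 𝓔 t₀ + C₂ * h * 𝓕 + ε * h * ν)) with hP
  have hPd : HasDerivAt P ((d * M + 1 + C₁) * 𝓔 t₀ + C₂ * 𝓕 + ε * ν) 0 := by
    have h1 : HasDerivAt (fun h : ℝ => (1 + h * M) ^ d) (d * M) 0 := by
      exact ((((hasDerivAt_id (0 : ℝ)).mul_const M).const_add 1).pow d).congr_deriv (by simp)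
    have h2 : HasDerivAt (fun h : ℝ => 1 + h) 1 0 := (hasDerivAt_id (0 : ℝ)).const_add 1
    have h3 : HasDerivAt (fun h : ℝ => (1 + C₁ * h) * 𝓔 t₀ + C₂ * h * 𝓕 + ε * h * ν)
        (C₁ * 𝓔 t₀ + C₂ * 𝓕 + ε * ν) 0 := by
      have ha := (((hasDerivAt_id (0 : ℝ)).const_mul C₁).const_add 1).mul_const (𝓔 t₀)
      have hb := ((hasDerivAt_id (0 : ℝ)).const_mul C₂).mul_const 𝓕
      have hc := ((hasDerivAt_id (0 : ℝ)).const_mul ε).mul_const ν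
      exact ((ha.add hb).add hc).congr_deriv (by simp)
    refine (h1.mul (h2.mul h3)).congr_deriv ?_
    simp only [Pi.mul_apply, zero_mul, mul_zero, add_zero, one_pow, one_mul]
    ring
  have hP0 : P 0 = 𝓔 t₀ := by simp [hP]
  have hPslope : ∀ᶠ h in 𝓝[>] (0 : ℝ), slope P 0 h < r := by
    have := (hasDerivAt_iff_tendsto_slope.1 hPd).mono_left
      (nhdsWithin_mono _ fun h (hh : 0 < h) => hh.ne')
    exact this.eventually (Iio_mem_nhds (by linarith))
  have hsmall : ∀ᶠ h in 𝓝[>] (0 : ℝ), h * M < 1 := by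
    refine Filter.Eventually.filter_mono nhdsWithin_le_nhds ?_
    exact (by fun_prop : Continuous fun h : ℝ => h * M).continuousAt.eventually
      (Iio_mem_nhds (by simp))
  have hmain : ∀ᶠ h in 𝓝[>] (0 : ℝ), slope 𝓔 t₀ (t₀ + h) < r := by
    filter_upwards [hPslope, hsmall, hstep ε hε0, self_mem_nhdsWithin] with h h1 h2 h3 hpos
    replace hpos : 0 < h := hpos
    refine lt_of_le_of_lt ?_ h1
    rw [slope_def_field, slope_def_field, hP0, add_sub_cancel_left, sub_zero]
    refine div_le_div_of_nonneg_right (sub_le_sub_right ?_ _) hpos.le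
    have hwG := integrable_coneWeight_mul μ hc hR ht₀ hGi
    have hw := integrable_coneWeight μ hc hR ht₀
    set H : E → ℝ := fun x => (1 + h) * ((1 + C₁ * h) * (coneWeight E c R x t₀ * G x t₀)
      + C₂ * h * f x + ε * h * coneWeight E c R x t₀) with hH
    have hHi : Integrable H μ :=
      (((hwG.const_mul _).add (hfi.const_mul _)).add (hw.const_mul _)).const_mul _
    have hHint : ∫ x, H x ∂μ = (1 + h) *
        ((1 + C₁ * h) * 𝓔 t₀ + C₂ * h * 𝓕 + ε * h * ν) := by
      simp only [hH]
      have hi₁ := (hwG.const_mul (1 + C₁ * h)).add (hfi.const_mul (C₂ * h))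
      rw [integral_const_mul]
      congr 1
      refine (integral_add hi₁ (hw.const_mul (ε * h))).trans ?_
      refine (congrArg₂ (· + ·) (integral_add (hwG.const_mul (1 + C₁ * h))
        (hfi.const_mul (C₂ * h))) rfl).trans ?_
      simp only [integral_const_mul]
      rfl
    have := integral_le_of_comp_add_smul_le μ hα hM hαM hpos.le h2
      (g := fun x => coneWeight E c R x (t₀ + h) * G x (t₀ + h)) (H := H)
      (fun x => mul_nonneg (coneWeight_nonneg _ _ _ _) (hG _ _)) hHi (fun x => by
        have hw1 := coneWeight_add_smul_le (x := x) hR (hαc x) t₀ hpos.le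
        have hw0 := coneWeight_nonneg c R x t₀
        have hwle := coneWeight_le_one hc hR.le x ht₀
        refine (mul_le_mul_of_nonneg_right hw1 (hG _ _)).trans ?_
        have hfx : coneWeight E c R x t₀ * f x ≤ f x := mul_le_of_le_one_left (hf x) hwle
        have hH' : coneWeight E c R x t₀ *
            ((1 + h) * ((1 + C₁ * h) * G x t₀ + C₂ * h * f x + ε * h)) ≤ H x := by
          have : (1 + h) * (C₂ * h * (coneWeight E c R x t₀ * f x))
              ≤ (1 + h) * (C₂ * h * f x) := by gcongr
          simp only [hH]
          linarith
        by_cases hx : x ∈ Metric.closedBall (0 : E) R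
        · exact (mul_le_mul_of_nonneg_left (h3 x hx) hw0).trans hH'
        · refine le_trans (le_of_eq ?_) hH'
          simp [coneWeight_eq_zero hc hR ht₀ hx])
    rw [hHint] at this
    exact this
  have hmap : Tendsto (fun z => z - t₀) (𝓝[>] t₀) (𝓝[>] 0) := by
    refine tendsto_nhdsWithin_of_tendsto_nhds_of_eventually_within _ ?_ ?_
    · have : Tendsto (fun z => z - t₀) (𝓝 t₀) (𝓝 (t₀ - t₀)) :=
        (by fun_prop : Continuous fun z => z - t₀).tendsto t₀
      rw [sub_self] at this
      exact this.mono_left nhdsWithin_le_nhds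
    · filter_upwards [self_mem_nhdsWithin] with z hz
      exact sub_pos.2 (mem_Ioi.1 hz)
  filter_upwards [hmap.eventually hmain] with z hz
  simpa using hz

end Analysis

section Source

variable {E : Type*} [NormedAddCommGroup E] [NormedSpace ℝ E]

/-- Leibniz bound for a product, given a common bound for the terms of the Leibniz formula. -/
theorem norm_iteratedFDeriv_mul_le_of_forall_le {p q : E → ℝ} {m : ℕ} (hp : ContDiff ℝ m p)
    (hq : ContDiff ℝ m q) {x : E} {M S : ℝ}
    (h : ∀ j ≤ m, ‖iteratedFDeriv ℝ j p x‖ * ‖iteratedFDeriv ℝ (m - j) q x‖ ≤ M * S) :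
    ‖iteratedFDeriv ℝ m (fun y => p y * q y) x‖ ≤ 2 ^ m * (M * S) := by
  refine (norm_iteratedFDeriv_mul_le hp hq x le_rfl).trans ?_
  have hsum : ((2 : ℝ) ^ m) = ∑ j ∈ Finset.range (m + 1), (m.choose j : ℝ) := by
    exact_mod_cast (Nat.sum_range_choose m).symm
  rw [hsum, Finset.sum_mul]
  refine Finset.sum_le_sum fun j hj => ?_
  rw [mul_assoc]
  exact mul_le_mul_of_nonneg_left (h j (Nat.lt_succ_iff.1 (Finset.mem_range.1 hj)))
    (Nat.cast_nonneg _)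

/-- Subtracting the frozen principal part leaves only derivatives of order at most `m`. -/
theorem norm_iteratedFDeriv_source_le {ι : Type*} [Fintype ι] {m : ℕ} {a : ι → E → ℝ}
    {b f g : E → ℝ} {e : ι → E} (he : ∀ i, ‖e i‖ ≤ 1) (ha : ∀ i, ContDiff ℝ m (a i))
    (hb : ContDiff ℝ m b) (hf : ContDiff ℝ m f) (hg : ContDiff ℝ (m + 1) g) {x₀ : E} {M S : ℝ}
    (hM : 0 ≤ M) (haM : ∀ i, ∀ j ≤ m, ‖iteratedFDeriv ℝ j (a i) x₀‖ ≤ M)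
    (hbM : ∀ j ≤ m, ‖iteratedFDeriv ℝ j b x₀‖ ≤ M)
    (hgS : ∀ j ≤ m, ‖iteratedFDeriv ℝ j g x₀‖ ≤ S) :
    ‖iteratedFDeriv ℝ m
        (fun x => f x - b x * g x - ∑ i, (a i x - a i x₀) * fderiv ℝ g x (e i)) x₀‖
      ≤ ‖iteratedFDeriv ℝ m f x₀‖ + (1 + Fintype.card ι) * (2 ^ m * (M * S)) := by
  have hS : 0 ≤ S := (norm_nonneg _).trans (hgS 0 (Nat.zero_le _))
  have hg' : ContDiff ℝ m g := hg.of_le (by exact_mod_cast Nat.le_succ m)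
  have hfd : ContDiff ℝ m (fderiv ℝ g) := hg.fderiv_right le_rfl
  have hde : ∀ i, ContDiff ℝ m (fun x => fderiv ℝ g x (e i)) := fun i =>
    hfd.clm_apply contDiff_const
  have hac : ∀ i, ContDiff ℝ m (fun x => a i x - a i x₀) := fun i => (ha i).sub contDiff_const
  have hsumc : ContDiff ℝ m (fun x => ∑ i, (a i x - a i x₀) * fderiv ℝ g x (e i)) :=
    ContDiff.sum fun i _ => (hac i).mul (hde i)
  have hbg : ContDiff ℝ m (fun x => b x * g x) := hb.mul hg'
  have hsplit : iteratedFDeriv ℝ m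
        (fun x => f x - b x * g x - ∑ i, (a i x - a i x₀) * fderiv ℝ g x (e i)) x₀
      = iteratedFDeriv ℝ m f x₀ - iteratedFDeriv ℝ m (fun x => b x * g x) x₀
        - ∑ i, iteratedFDeriv ℝ m (fun x => (a i x - a i x₀) * fderiv ℝ g x (e i)) x₀ := by
    have h1 := iteratedFDeriv_sub_apply (hf.sub hbg).contDiffAt hsumc.contDiffAt (x := x₀)
    have h2 := iteratedFDeriv_sub_apply hf.contDiffAt hbg.contDiffAt (x := x₀)
    have h3 := congrFun (iteratedFDeriv_sum (u := Finset.univ)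
      (f := fun i x => (a i x - a i x₀) * fderiv ℝ g x (e i)) (i := m)
      fun i _ => (hac i).mul (hde i)) x₀
    rw [Finset.sum_apply] at h3
    rw [← h3]
    exact h1.trans (congrArg (· - _) h2)
  have hb1 : ‖iteratedFDeriv ℝ m (fun x => b x * g x) x₀‖ ≤ 2 ^ m * (M * S) :=
    norm_iteratedFDeriv_mul_le_of_forall_le hb hg' fun j hj =>
      mul_le_mul (hbM j hj) (hgS _ (Nat.sub_le _ _)) (norm_nonneg _) hM
  have ha1 : ∀ i, ‖iteratedFDeriv ℝ m (fun x => (a i x - a i x₀) * fderiv ℝ g x (e i)) x₀‖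
      ≤ 2 ^ m * (M * S) := fun i => by
    refine norm_iteratedFDeriv_mul_le_of_forall_le (hac i) (hde i) fun j hj => ?_
    rcases Nat.eq_zero_or_pos j with rfl | hj0
    · simpa using mul_nonneg hM hS
    · have hj1 : iteratedFDeriv ℝ j (fun x => a i x - a i x₀) x₀ = iteratedFDeriv ℝ j (a i) x₀ := by
        have hj' : ContDiff ℝ j (a i) := (ha i).of_le (by exact_mod_cast hj)
        have := iteratedFDeriv_sub_apply hj'.contDiffAt
          (contDiff_const (c := a i x₀)).contDiffAt (x := x₀) (i := j)
        rw [iteratedFDeriv_const_of_ne hj0.ne'] at this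
        rw [Pi.zero_apply, sub_zero] at this
        exact this
      rw [hj1]
      refine mul_le_mul (haM i j hj) ?_ (norm_nonneg _) hM
      refine (norm_iteratedFDeriv_clm_apply_const (N := m) hfd.contDiffAt
        (by exact_mod_cast Nat.sub_le m j)).trans ?_
      rw [norm_iteratedFDeriv_fderiv]
      exact (mul_le_of_le_one_left (norm_nonneg _) (he i)).trans (hgS _ (by omega))
  rw [hsplit]
  refine (norm_sub_le _ _).trans ?_
  refine (add_le_add (norm_sub_le _ _) (norm_sum_le _ _)).trans ?_
  have : ∑ i, ‖iteratedFDeriv ℝ m (fun x => (a i x - a i x₀) * fderiv ℝ g x (e i)) x₀‖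
      ≤ Fintype.card ι * (2 ^ m * (M * S)) := by
    refine (Finset.sum_le_sum fun i _ => ha1 i).trans ?_
    simp
  linarith

/-- Sum of squares of quantities growing at a controlled rate. -/
theorem sum_sq_le_of_le_add_mul {k : ℕ} {V V' f : ℕ → ℝ} {C ε h : ℝ} (hh : 0 ≤ h)
    (hV' : ∀ m ∈ Finset.range (k + 1), 0 ≤ V' m)
    (hle : ∀ m ∈ Finset.range (k + 1), V' m ≤
      V m + h * (f m + C * (∑ j ∈ Finset.range (k + 1), V j) + ε)) :
    ∑ m ∈ Finset.range (k + 1), V' m ^ 2 ≤ (1 + h) *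
      ((1 + 3 * C ^ 2 * (k + 1) ^ 2 * h) * ∑ m ∈ Finset.range (k + 1), V m ^ 2
        + 3 * h * ∑ m ∈ Finset.range (k + 1), f m ^ 2 + 3 * (k + 1) * ε ^ 2 * h) := by
  set S := ∑ j ∈ Finset.range (k + 1), V j with hS
  have hcs : S ^ 2 ≤ (k + 1) * ∑ m ∈ Finset.range (k + 1), V m ^ 2 := by
    simpa using sq_sum_le_card_mul_sum_sq (s := Finset.range (k + 1)) (f := V)
  have hterm : ∀ m ∈ Finset.range (k + 1), V' m ^ 2 ≤
      (1 + h) * (V m ^ 2 + h * (3 * (f m ^ 2 + C ^ 2 * S ^ 2 + ε ^ 2))) := by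
    intro m hm
    set β := f m + C * S + ε with hβ
    have h1 : V' m ^ 2 ≤ (V m + h * β) ^ 2 := pow_le_pow_left₀ (hV' m hm) (hle m hm) 2
    have h2 : (V m + h * β) ^ 2 ≤ (1 + h) * (V m ^ 2 + h * β ^ 2) := by
      nlinarith [mul_nonneg hh (sq_nonneg (V m - β))]
    have h3 : β ^ 2 ≤ 3 * (f m ^ 2 + C ^ 2 * S ^ 2 + ε ^ 2) := by
      rw [hβ]
      nlinarith [sq_nonneg (f m - C * S), sq_nonneg (f m - ε), sq_nonneg (C * S - ε)]
    refine h1.trans (h2.trans ?_)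
    gcongr
  refine (Finset.sum_le_sum hterm).trans ?_
  rw [← Finset.mul_sum]
  refine mul_le_mul_of_nonneg_left ?_ (by linarith)
  rw [Finset.sum_add_distrib, ← Finset.mul_sum, ← Finset.mul_sum, Finset.sum_add_distrib,
    Finset.sum_add_distrib]
  simp only [Finset.sum_const, Finset.card_range, nsmul_eq_mul, Nat.cast_add, Nat.cast_one]
  have : h * ((k + 1) * (C ^ 2 * S ^ 2)) ≤
      h * ((k + 1) * (C ^ 2 * ((k + 1) * ∑ m ∈ Finset.range (k + 1), V m ^ 2))) := by gcongr
  linarith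

/-- A derivative of the iterated space derivative, in terms of the space-time derivative. -/
theorem fderiv_iteratedFDeriv_slice {F : Type*} [NormedAddCommGroup F] [NormedSpace ℝ F]
    {U : E × ℝ → F} {I : Set ℝ} (hI : IsOpen I) {m : ℕ}
    (hU : ContDiffOn ℝ (m + 1) U (univ ×ˢ I)) {t : ℝ} (ht : t ∈ I) (x : E) (e : E × ℝ) :
    fderiv ℝ (fun p : E × ℝ => iteratedFDeriv ℝ m (fun y => U (y, p.2)) p.1) (x, t) e
      = iteratedFDeriv ℝ m (fun y => fderiv ℝ U (y, t) e) x := by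
  have hopen : IsOpen ((univ : Set E) ×ˢ I) := isOpen_univ.prod hI
  have hmem : (x, t) ∈ (univ : Set E) ×ˢ I := ⟨mem_univ _, ht⟩
  have hUat : ContDiffAt ℝ (m + 1) U (x, t) := hU.contDiffAt (hopen.mem_nhds hmem)
  let L : ((E × ℝ) [×m]→L[ℝ] F) →L[ℝ] (E [×m]→L[ℝ] F) :=
    ContinuousMultilinearMap.compContinuousLinearMapL fun _ => ContinuousLinearMap.inl ℝ E ℝ
  have hslice : ∀ {W : E × ℝ → F}, ContDiffOn ℝ m W (univ ×ˢ I) → ∀ p ∈ (univ : Set E) ×ˢ I,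
      iteratedFDeriv ℝ m (fun y => W (y, p.2)) p.1 = L (iteratedFDeriv ℝ m W p) := by
    intro W hW p hp
    rw [iteratedFDeriv_slice hI.uniqueDiffOn hW le_rfl hp.2 p.1,
      iteratedFDerivWithin_of_isOpen m hopen hp]
    rfl
  have hev : (fun p : E × ℝ => iteratedFDeriv ℝ m (fun y => U (y, p.2)) p.1)
      =ᶠ[𝓝 (x, t)] ⇑L ∘ iteratedFDeriv ℝ m U :=
    eventually_of_mem (hopen.mem_nhds hmem)
      (hslice (hU.of_le (by exact_mod_cast Nat.le_succ m)))
  have hd : DifferentiableAt ℝ (iteratedFDeriv ℝ m U) (x, t) :=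
    (hUat.iteratedFDeriv_right (m := 1) (by rw [add_comm])).differentiableAt (by norm_num)
  have hdir : ContDiffOn ℝ m (fun q => fderiv ℝ U q e) (univ ×ˢ I) :=
    (hU.fderiv_of_isOpen hopen le_rfl).clm_apply contDiffOn_const
  rw [hev.fderiv_eq, (L.hasFDerivAt.comp (x, t) hd.hasFDerivAt).fderiv,
    ContinuousLinearMap.comp_apply, fderiv_iteratedFDeriv_apply e m hUat]
  exact (hslice hdir (x, t) hmem).symm

theorem contDiffOn_iteratedFDeriv_slice {F : Type*} [NormedAddCommGroup F] [NormedSpace ℝ F]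
    {U : E × ℝ → F} {I : Set ℝ} (hI : UniqueDiffOn ℝ I) {k m : ℕ} (hm : m ≤ k)
    (hU : ContDiffOn ℝ (k + 1) U (univ ×ˢ I)) :
    ContDiffOn ℝ 1 (fun p : E × ℝ => iteratedFDeriv ℝ m (fun y => U (y, p.2)) p.1)
      (univ ×ˢ I) := by
  let L : ((E × ℝ) [×m]→L[ℝ] F) →L[ℝ] (E [×m]→L[ℝ] F) :=
    ContinuousMultilinearMap.compContinuousLinearMapL fun _ => ContinuousLinearMap.inl ℝ E ℝ
  have h1 : ContDiffOn ℝ 1 (iteratedFDerivWithin ℝ m U (univ ×ˢ I)) (univ ×ˢ I) := fun p hp =>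
    (hU p hp).iteratedFDerivWithin_right (uniqueDiffOn_univ.prod hI)
      (by rw [add_comm]; exact_mod_cast Nat.succ_le_succ hm) hp
  refine (L.contDiff.comp_contDiffOn h1).congr fun p hp => ?_
  have hU' : ContDiffOn ℝ (k + 1 : ℕ) U (univ ×ˢ I) := by exact_mod_cast hU
  exact iteratedFDeriv_slice hI hU' (by omega) hp.2 p.1

end Source

section Transport

variable {E : Type*} [NormedAddCommGroup E] [NormedSpace ℝ E]

theorem ContDiffOn.contDiff_slice {F : Type*} [NormedAddCommGroup F] [NormedSpace ℝ F]
    {U : E × ℝ → F} {I : Set ℝ} {N : WithTop ℕ∞} (hU : ContDiffOn ℝ N U (univ ×ˢ I)) {t : ℝ}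
    (ht : t ∈ I) : ContDiff ℝ N (fun x => U (x, t)) :=
  contDiffOn_univ.1 <| hU.comp (contDiff_id.prodMk contDiff_const).contDiffOn
    fun x _ => ⟨mem_univ x, ht⟩

/-- Along characteristics, the space derivatives of a solution of the transport equation
`u_t + ∑ aᵢ ∂ᵢu + b u = f` are driven by `f` and by derivatives of no higher order. -/
theorem norm_fderiv_iteratedFDeriv_slice_le {ι : Type*} [Fintype ι] {I : Set ℝ} (hI : IsOpen I)
    {m : ℕ} {a : ι → E → ℝ → ℝ} {b f u : E → ℝ → ℝ} {e : ι → E} (he : ∀ i, ‖e i‖ ≤ 1)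
    (ha : ∀ i, ContDiffOn ℝ m (fun p : E × ℝ => a i p.1 p.2) (univ ×ˢ I))
    (hb : ContDiffOn ℝ m (fun p : E × ℝ => b p.1 p.2) (univ ×ˢ I))
    (hu : ContDiffOn ℝ (m + 1) (fun p : E × ℝ => u p.1 p.2) (univ ×ˢ I))
    {t : ℝ} (ht : t ∈ I)
    (hpde : ∀ x, deriv (fun s => u x s) t + (∑ i, a i x t * fderiv ℝ (fun y => u y t) x (e i))
      + b x t * u x t = f x t)
    {x₀ : E} {M S : ℝ} (hM : 0 ≤ M)
    (haM : ∀ i, ∀ j ≤ m, ‖iteratedFDeriv ℝ j (fun y => a i y t) x₀‖ ≤ M)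
    (hbM : ∀ j ≤ m, ‖iteratedFDeriv ℝ j (fun y => b y t) x₀‖ ≤ M)
    (huS : ∀ j ≤ m, ‖iteratedFDeriv ℝ j (fun y => u y t) x₀‖ ≤ S) :
    ‖fderiv ℝ (fun p : E × ℝ => iteratedFDeriv ℝ m (fun y => u y p.2) p.1) (x₀, t)
        (∑ i, a i x₀ t • e i, 1)‖
      ≤ ‖iteratedFDeriv ℝ m (fun y => f y t) x₀‖
        + (1 + Fintype.card ι) * (2 ^ m * (M * S)) := by
  set U : E × ℝ → ℝ := fun p => u p.1 p.2 with hUdef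
  have hopen : IsOpen ((univ : Set E) ×ˢ I) := isOpen_univ.prod hI
  have hd : ∀ x, HasFDerivAt U (fderiv ℝ U (x, t)) (x, t) := fun x =>
    (((hu.contDiffAt (hopen.mem_nhds ⟨mem_univ x, ht⟩)).differentiableAt
      (by simp)).hasFDerivAt)
  have htime : ∀ x, deriv (fun s => u x s) t = fderiv ℝ U (x, t) (0, 1) := fun x =>
    ((hd x).comp_hasDerivAt t ((hasDerivAt_const t x).prodMk (hasDerivAt_id t))).deriv
  have hspace : ∀ x v, fderiv ℝ (fun y => u y t) x v = fderiv ℝ U (x, t) (v, 0) := fun x v => by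
    have h := (HasFDerivAt.comp (g := U) (f := fun y => (y, t)) x (hd x)
      ((hasFDerivAt_id x).prodMk (hasFDerivAt_const t x))).fderiv
    exact (congrArg (fun L : E →L[ℝ] ℝ => L v) h).trans (by simp)
  have hut : ContDiff ℝ (m + 1) (fun y => u y t) := hu.contDiff_slice ht
  have hat : ∀ i, ContDiff ℝ m (fun y => a i y t) := fun i => (ha i).contDiff_slice ht
  have hbt : ContDiff ℝ m (fun y => b y t) := hb.contDiff_slice ht
  have hft : ContDiff ℝ m (fun y => f y t) := by
    have h1 : ContDiff ℝ m (fun x => fderiv ℝ U (x, t) (0, 1)) :=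
      ((hu.fderiv_of_isOpen hopen le_rfl).contDiff_slice ht).clm_apply contDiff_const
    have h2 : ContDiff ℝ m (fun x => ∑ i, a i x t * fderiv ℝ (fun y => u y t) x (e i)) :=
      ContDiff.sum fun i _ => (hat i).mul ((hut.fderiv_right le_rfl).clm_apply contDiff_const)
    have h3 : ContDiff ℝ m (fun x => b x t * u x t) :=
      hbt.mul (hut.of_le (by exact_mod_cast Nat.le_succ m))
    convert (h1.add h2).add h3 using 1
    funext x
    rw [← hpde x, htime x]
  have hfun : (fun y => fderiv ℝ U (y, t) (∑ i, a i x₀ t • e i, 1)) = fun x => f x t - b x t * u x t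
      - ∑ i, (a i x t - a i x₀ t) * fderiv ℝ (fun y => u y t) x (e i) := by
    funext x
    have hsplit : ((∑ i, a i x₀ t • e i, 1) : E × ℝ)
        = (0, 1) + ContinuousLinearMap.inl ℝ E ℝ (∑ i, a i x₀ t • e i) := by
      rw [ContinuousLinearMap.inl_apply]; simp
    have hlin : fderiv ℝ U (x, t) (ContinuousLinearMap.inl ℝ E ℝ (∑ i, a i x₀ t • e i))
        = ∑ i, a i x₀ t * fderiv ℝ (fun y => u y t) x (e i) := by
      simp only [map_sum, map_smul, smul_eq_mul, hspace, ContinuousLinearMap.inl_apply]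
    rw [hsplit, map_add, hlin, ← hpde x, htime x]
    simp only [sub_mul, Finset.sum_sub_distrib]
    ring
  rw [fderiv_iteratedFDeriv_slice hI hu ht x₀, hfun]
  exact norm_iteratedFDeriv_source_le he hat hbt hft hut hM haM hbM huS

/-- One explicit time step of size `h` along the characteristics. -/
theorem eventually_sum_sq_iteratedFDeriv_le {ι : Type*} [Fintype ι] {T : ℝ} {k : ℕ}
    {a : ι → E → ℝ → ℝ} {b f u : E → ℝ → ℝ} {e : ι → E} (he : ∀ i, ‖e i‖ ≤ 1)
    (ha : ∀ i, ContDiffOn ℝ k (fun p : E × ℝ => a i p.1 p.2) (univ ×ˢ Ioo 0 T))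
    (hb : ContDiffOn ℝ k (fun p : E × ℝ => b p.1 p.2) (univ ×ˢ Ioo 0 T))
    (hu : ContDiffOn ℝ (k + 1) (fun p : E × ℝ => u p.1 p.2) (univ ×ˢ Ioo 0 T))
    {t : ℝ} (ht : t ∈ Ioo 0 T)
    (hpde : ∀ x, deriv (fun s => u x s) t + (∑ i, a i x t * fderiv ℝ (fun y => u y t) x (e i))
      + b x t * u x t = f x t)
    {M : ℝ} (hM : 0 ≤ M)
    (haM : ∀ i, ∀ j ≤ k, ∀ x, ‖iteratedFDeriv ℝ j (fun y => a i y t) x‖ ≤ M)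
    (hbM : ∀ j ≤ k, ∀ x, ‖iteratedFDeriv ℝ j (fun y => b y t) x‖ ≤ M)
    {K : Set E} (hK : IsCompact K) {ε : ℝ} (hε : 0 < ε) :
    ∀ᶠ h in 𝓝[>] (0 : ℝ), ∀ x ∈ K,
      ∑ m ∈ Finset.range (k + 1),
          ‖iteratedFDeriv ℝ m (fun y => u y (t + h)) (x + h • ∑ i, a i x t • e i)‖ ^ 2
        ≤ (1 + h) *
          ((1 + 3 * ((1 + Fintype.card ι) * (2 ^ k * M)) ^ 2 * (k + 1) ^ 2 * h)
              * ∑ m ∈ Finset.range (k + 1), ‖iteratedFDeriv ℝ m (fun y => u y t) x‖ ^ 2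
            + 3 * h * ∑ m ∈ Finset.range (k + 1), ‖iteratedFDeriv ℝ m (fun y => f y t) x‖ ^ 2
            + ε * h) := by
  set C : ℝ := (1 + Fintype.card ι) * (2 ^ k * M) with hC
  obtain ⟨η, hη, hηε⟩ : ∃ η : ℝ, 0 < η ∧ 3 * (k + 1) * η ^ 2 = ε := by
    refine ⟨√(ε / (3 * (k + 1))), by positivity, ?_⟩
    rw [Real.sq_sqrt (by positivity)]
    field_simp
  have hα : Continuous fun x => ∑ i, a i x t • e i :=
    continuous_finsetSum _ fun i _ => ((ha i).contDiff_slice ht).continuous.smul continuous_const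
  have hstep : ∀ᶠ h in 𝓝[>] (0 : ℝ), ∀ m ∈ Finset.range (k + 1), ∀ x ∈ K,
      ‖iteratedFDeriv ℝ m (fun y => u y (t + h)) (x + h • ∑ i, a i x t • e i)
          - iteratedFDeriv ℝ m (fun y => u y t) x
          - h • fderiv ℝ (fun p : E × ℝ => iteratedFDeriv ℝ m (fun y => u y p.2) p.1) (x, t)
            (∑ i, a i x t • e i, 1)‖ ≤ η * h := by
    refine (Filter.eventually_all_finset _).2 fun m hm => ?_
    exact eventually_norm_sub_le_of_isCompact ht
      (contDiffOn_iteratedFDeriv_slice isOpen_Ioo.uniqueDiffOn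
        (Nat.lt_succ_iff.1 (Finset.mem_range.1 hm)) hu) hα hK hη
  filter_upwards [hstep, self_mem_nhdsWithin] with h hh (hpos : 0 < h) x hx
  have key := sum_sq_le_of_le_add_mul (k := k) (C := C) (ε := η) (h := h)
    (V := fun m => ‖iteratedFDeriv ℝ m (fun y => u y t) x‖)
    (V' := fun m => ‖iteratedFDeriv ℝ m (fun y => u y (t + h)) (x + h • ∑ i, a i x t • e i)‖)
    (f := fun m => ‖iteratedFDeriv ℝ m (fun y => f y t) x‖) hpos.le
    (fun m _ => norm_nonneg _) fun m hm => ?_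
  · rwa [hηε] at key
  have hmk : m ≤ k := Nat.lt_succ_iff.1 (Finset.mem_range.1 hm)
  set S := ∑ j ∈ Finset.range (k + 1), ‖iteratedFDeriv ℝ j (fun y => u y t) x‖ with hS
  have hS0 : 0 ≤ S := Finset.sum_nonneg fun j _ => norm_nonneg _
  have hD := norm_fderiv_iteratedFDeriv_slice_le (m := m) (x₀ := x) (S := S) isOpen_Ioo he
    (fun i => (ha i).of_le (by exact_mod_cast hmk)) (hb.of_le (by exact_mod_cast hmk))
    (hu.of_le (by exact_mod_cast Nat.succ_le_succ hmk)) ht hpde hM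
    (fun i j hj => haM i j (hj.trans hmk) x) (fun j hj => hbM j (hj.trans hmk) x)
    (fun j hj => Finset.single_le_sum
      (f := fun j => ‖iteratedFDeriv ℝ j (fun y => u y t) x‖)
      (fun _ _ => norm_nonneg _) (Finset.mem_range.2 (by omega)))
  have hpow : (1 + (Fintype.card ι : ℝ)) * (2 ^ m * (M * S)) ≤ C * S := by
    have h2 : (2 : ℝ) ^ m ≤ 2 ^ k := pow_le_pow_right₀ one_le_two hmk
    calc (1 + (Fintype.card ι : ℝ)) * (2 ^ m * (M * S))
        ≤ (1 + (Fintype.card ι : ℝ)) * (2 ^ k * (M * S)) := by gcongr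
      _ = C * S := by rw [hC]; ring
  set D := fderiv ℝ (fun p : E × ℝ => iteratedFDeriv ℝ m (fun y => u y p.2) p.1) (x, t)
    (∑ i, a i x t • e i, 1) with hDdef
  set P := iteratedFDeriv ℝ m (fun y => u y (t + h)) (x + h • ∑ i, a i x t • e i)
  set Q := iteratedFDeriv ℝ m (fun y => u y t) x
  have hP : P = Q + h • D + (P - Q - h • D) := by abel
  calc ‖P‖ ≤ ‖Q‖ + ‖h • D‖ + ‖P - Q - h • D‖ := by
        conv_lhs => rw [hP]
        exact norm_add₃_le
    _ ≤ ‖Q‖ + h * (‖iteratedFDeriv ℝ m (fun y => f y t) x‖ + C * S) + η * h := by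
        rw [norm_smul, Real.norm_of_nonneg hpos.le]
        gcongr
        · exact hD.trans (by gcongr)
        · exact hh m hm x hx
    _ = ‖Q‖ + h * (‖iteratedFDeriv ℝ m (fun y => f y t) x‖ + C * S + η) := by ring

end Transport

section EnergyEstimate

variable {n k : ℕ}

theorem hkNormSq_eq_integral {g : EuclideanSpace ℝ (Fin n) → ℝ} (hg : MemHk n k g) :
    HkNormSq n k g
      = ∫ x, ∑ m ∈ Finset.range (k + 1), ‖iteratedFDeriv ℝ m g x‖ ^ 2 :=
  (integral_finsetSum _ fun m hm => hg m (Nat.lt_succ_iff.1 (Finset.mem_range.1 hm))).symm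

theorem MemHk.integrable_sum {g : EuclideanSpace ℝ (Fin n) → ℝ} (hg : MemHk n k g) :
    Integrable fun x => ∑ m ∈ Finset.range (k + 1), ‖iteratedFDeriv ℝ m g x‖ ^ 2 :=
  integrable_finsetSum _ fun m hm => hg m (Nat.lt_succ_iff.1 (Finset.mem_range.1 hm))

theorem norm_fderiv_sum_smul_single_le {a : Fin n → EuclideanSpace ℝ (Fin n) → ℝ} {M : ℝ}
    {x : EuclideanSpace ℝ (Fin n)} (ha : ∀ i, DifferentiableAt ℝ (a i) x)
    (haM : ∀ i, ‖fderiv ℝ (a i) x‖ ≤ M) :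
    ‖fderiv ℝ (fun y => ∑ i, a i y • EuclideanSpace.single i (1 : ℝ)) x‖ ≤ n * M := by
  have h : HasFDerivAt (fun y => ∑ i, a i y • EuclideanSpace.single i (1 : ℝ))
      (∑ i, (fderiv ℝ (a i) x).smulRight (EuclideanSpace.single i (1 : ℝ))) x :=
    HasFDerivAt.fun_sum fun i _ => (ha i).hasFDerivAt.smul_const _
  rw [h.fderiv]
  refine (norm_sum_le _ _).trans ((Finset.sum_le_sum fun i _ => ?_).trans_eq
    (by simp : ∑ _i : Fin n, M = n * M))
  simpa [ContinuousLinearMap.norm_smulRight_apply] using haM i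

theorem norm_sum_smul_single_le {v A : Fin n → ℝ} (h : ∀ i, |v i| ≤ A i) :
    ‖∑ i, v i • EuclideanSpace.single i (1 : ℝ)‖ ≤ ∑ i, A i :=
  norm_sum_le_of_le _ fun i _ => by simpa [norm_smul] using h i

end EnergyEstimate

/-- `H^k` energy estimate for a first order hyperbolic PDE
`u_t + ∑ aᵢ u_{xᵢ} + b u = f` on `ℝⁿ × [0,T]`: there are constants `δ₀, C₀ > 0`
depending only on the bounds `Ma, Mb` on the (spatial) derivatives of `a` and `b`
(and on `n`, `k`, `T`, `κ`) such that
`e^{−δ₀ t} ‖u(t)‖²_{H^k} ≤ ‖u₀‖²_{H^k} + C₀ ∫₀ᵗ e^{−δ₀ s} ‖f(s)‖²_{H^k} ds`. -/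
theorem energy_estimate_Hk
    (n k : ℕ) (hn : 1 ≤ n) (hk : 1 ≤ k) (T κ Ma Mb : ℝ) (hT : 0 < T) (hκ : 0 < κ) :
    ∃ δ₀ : ℝ, 0 < δ₀ ∧ ∃ C₀ : ℝ, 0 < C₀ ∧
      ∀ (a : Fin n → EuclideanSpace ℝ (Fin n) → ℝ → ℝ)
        (b f u : EuclideanSpace ℝ (Fin n) → ℝ → ℝ)
        (u₀ : EuclideanSpace ℝ (Fin n) → ℝ)
        (A : Fin n → ℝ),
        -- `a i` and `b` are smooth on `ℝⁿ × [0,T]`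
        (∀ i, ContDiffOn ℝ (⊤ : ℕ∞) (fun p : EuclideanSpace ℝ (Fin n) × ℝ => a i p.1 p.2)
          (Set.univ ×ˢ Set.Icc 0 T)) →
        ContDiffOn ℝ (⊤ : ℕ∞) (fun p : EuclideanSpace ℝ (Fin n) × ℝ => b p.1 p.2)
          (Set.univ ×ˢ Set.Icc 0 T) →
        -- the spatial derivatives of `a` and `b` up to order `k` are bounded by `Ma`, `Mb`
        (∀ i, ∀ m : ℕ, m ≤ k → ∀ x, ∀ t ∈ Set.Icc (0:ℝ) T,
          ‖iteratedFDeriv ℝ m (fun y => a i y t) x‖ ≤ Ma) →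
        (∀ m : ℕ, m ≤ k → ∀ x, ∀ t ∈ Set.Icc (0:ℝ) T,
          ‖iteratedFDeriv ℝ m (fun y => b y t) x‖ ≤ Mb) →
        -- `∑ᵢ sup_{(x,t)} |aᵢ(x,t)| ≤ 1/κ`
        (∀ i, ∀ x, ∀ t ∈ Set.Icc (0:ℝ) T, |a i x t| ≤ A i) →
        (∑ i, A i ≤ 1 / κ) →
        -- `u` is a `C^{k+1}` solution of the PDE with initial value `u₀`
        ContDiffOn ℝ (k + 1) (fun p : EuclideanSpace ℝ (Fin n) × ℝ => u p.1 p.2)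
          (Set.univ ×ˢ Set.Icc 0 T) →
        (∀ x, ∀ t ∈ Set.Icc (0:ℝ) T,
          deriv (fun s => u x s) t
            + (∑ i, a i x t * fderiv ℝ (fun y => u y t) x (EuclideanSpace.single i 1))
            + b x t * u x t = f x t) →
        (∀ x, u x 0 = u₀ x) →
        -- `∂^α_x u(t,·) ∈ L²` for all `|α| ≤ k`
        (∀ t ∈ Set.Icc (0:ℝ) T, MemHk n k (fun x => u x t)) →
        -- `u₀ ∈ H^k`
        MemHk n k u₀ →
        -- `f ∈ C([0,T]; H^k)`
        (∀ t ∈ Set.Icc (0:ℝ) T, MemHk n k (fun x => f x t)) →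
        ContinuousOn (fun t => HkNormSq n k (fun x => f x t)) (Set.Icc 0 T) →
        ∀ t ∈ Set.Icc (0:ℝ) T,
          Real.exp (-δ₀ * t) * HkNormSq n k (fun x => u x t)
            ≤ HkNormSq n k u₀
              + C₀ * ∫ s in (0:ℝ)..t, Real.exp (-δ₀ * s) * HkNormSq n k (fun x => f x s) := by
  set M : ℝ := |Ma| + |Mb| with hM
  set C₁ : ℝ := 3 * ((1 + Fintype.card (Fin n)) * (2 ^ k * M)) ^ 2 * (k + 1) ^ 2 with hC₁
  refine ⟨n * (n * M) + 1 + C₁, by positivity, 3, by norm_num, ?_⟩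
  intro a b f u u₀ A ha hb haM hbM hA hAκ hu hpde hu0 huH hu₀H hfH hφ t ht
  set c : ℝ := 1 / κ with hc_def
  have hc : 0 ≤ c := by positivity
  set G : EuclideanSpace ℝ (Fin n) → ℝ → ℝ := fun x s =>
    ∑ m ∈ Finset.range (k + 1), ‖iteratedFDeriv ℝ m (fun y => u y s) x‖ ^ 2 with hG
  have hG0 : ∀ x s, 0 ≤ G x s := fun x s => Finset.sum_nonneg fun m _ => sq_nonneg _
  have hGi : ∀ s ∈ Icc 0 T, Integrable fun x => G x s := fun s hs => (huH s hs).integrable_sum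
  have hGc : ContinuousOn (fun p : EuclideanSpace ℝ (Fin n) × ℝ => G p.1 p.2) (univ ×ˢ Icc 0 T) :=
    continuousOn_finsetSum _ fun m hm =>
      ((contDiffOn_iteratedFDeriv_slice (uniqueDiffOn_Icc hT)
        (Nat.lt_succ_iff.1 (Finset.mem_range.1 hm)) hu).continuousOn.norm.pow 2)
  have hsub : (univ : Set (EuclideanSpace ℝ (Fin n))) ×ˢ Ioo 0 T ⊆ univ ×ˢ Icc 0 T :=
    prod_mono_right Ioo_subset_Icc_self
  have hM0 : 0 ≤ M := by positivity
  have haM' : ∀ s ∈ Icc 0 T, ∀ i, ∀ j ≤ k, ∀ x, ‖iteratedFDeriv ℝ j (fun y => a i y s) x‖ ≤ M :=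
    fun s hs i j hj x => (haM i j hj x s hs).trans
      ((le_abs_self Ma).trans (le_add_of_nonneg_right (abs_nonneg Mb)))
  have hbM' : ∀ s ∈ Icc 0 T, ∀ j ≤ k, ∀ x, ‖iteratedFDeriv ℝ j (fun y => b y s) x‖ ≤ M :=
    fun s hs j hj x => (hbM j hj x s hs).trans
      ((le_abs_self Mb).trans (le_add_of_nonneg_left (abs_nonneg Ma)))
  have hcone : ∀ N : ℕ, Real.exp (-(n * (n * M) + 1 + C₁) * t)
        * ∫ x, coneWeight (EuclideanSpace ℝ (Fin n)) c (N + 1) x t * G x t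
      ≤ (∫ x, coneWeight (EuclideanSpace ℝ (Fin n)) c (N + 1) x 0 * G x 0)
        + 3 * ∫ s in (0:ℝ)..t, Real.exp (-(n * (n * M) + 1 + C₁) * s)
          * HkNormSq n k (fun x => f x s) := by
    intro N
    have hR : (0 : ℝ) < N + 1 := by positivity
    refine exp_neg_mul_le_of_eventually_slope_lt
      (y := fun s => ∫ x, coneWeight (EuclideanSpace ℝ (Fin n)) c (N + 1) x s * G x s)
      (continuousOn_integral_coneWeight_mul volume hc hR hGc) hφ ?_ ht
    intro s hs r hr
    have hs' := Ioo_subset_Icc_self hs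
    have has : ∀ i, ContDiff ℝ (⊤ : ℕ∞) (fun y => a i y s) := fun i =>
      (ha i).contDiff_slice hs'
    have had : ∀ i, Differentiable ℝ (fun y => a i y s) := fun i =>
      (has i).differentiable (by simp)
    refine eventually_slope_integral_coneWeight_lt volume
      (α := fun x => ∑ i, a i x s • EuclideanSpace.single i (1 : ℝ))
      (M := n * M) (C₁ := C₁) (C₂ := 3)
      (f := fun x => ∑ m ∈ Finset.range (k + 1), ‖iteratedFDeriv ℝ m (fun y => f y s) x‖ ^ 2)
      ?_ (by positivity) ?_ ?_ hR hs'.1 (by norm_num) hG0 ?_ (hGi s hs')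
      (hfH s hs').integrable_sum ?_ ?_
    · exact Differentiable.fun_sum fun i _ => (had i).smul_const _
    · intro x
      refine norm_fderiv_sum_smul_single_le (fun i => (had i) x) fun i => ?_
      rw [← norm_iteratedFDeriv_one]
      exact haM' s hs' i 1 hk x
    · exact fun x => (norm_sum_smul_single_le fun i => hA i x s hs').trans hAκ
    · exact fun x => Finset.sum_nonneg fun m _ => sq_nonneg _
    · intro ε hε
      exact eventually_sum_sq_iteratedFDeriv_le (fun i => by simp)
        (fun i => ((ha i).mono hsub).of_le (by exact_mod_cast le_top))
        ((hb.mono hsub).of_le (by exact_mod_cast le_top)) (hu.mono hsub) hs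
        (fun x => hpde x s hs') hM0 (haM' s hs') (hbM' s hs') (isCompact_closedBall _ _) hε
    · refine lt_of_le_of_lt ?_ hr
      rw [finrank_euclideanSpace_fin, hkNormSq_eq_integral (hfH s hs')]
  have hlim : ∀ s ∈ Icc 0 T, Tendsto
      (fun N : ℕ => ∫ x, coneWeight (EuclideanSpace ℝ (Fin n)) c (N + 1) x s * G x s) atTop
      (𝓝 (HkNormSq n k fun x => u x s)) := fun s hs => by
    rw [hkNormSq_eq_integral (huH s hs)]
    exact tendsto_integral_coneWeight_mul volume hc hs.1 (hGi s hs)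
  have h0 : u₀ = fun x => u x 0 := funext fun x => (hu0 x).symm
  rw [h0]
  exact le_of_tendsto_of_tendsto' ((hlim t ht).const_mul _)
    ((hlim 0 ⟨le_rfl, hT.le⟩).add_const _) hcone
end
end

section
/- Let m > 0. There exists a constant C > 0 depending only on m such that for all real numbers e₁, e₂ ≥ m, setting u⁰₁(u) = √(1 + e₁²|u|²) and u⁰₂(u) = √(1 + e₂²|u|²), the function g : ℝ³ → ℝ defined by g(u) = |u|² / ( (u⁰₁(u) + u⁰₂(u)) · u⁰₂(u) ) satisfies |g(u)| ≤ C, |∂_i g(u)| ≤ C, and |∂²_{ij} g(u)| ≤ C for all u ∈ ℝ³ and all i, j ∈ {1,2,3}. -/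
open Real

noncomputable section

/-- `f` is positive and twice differentiable on `[0, ∞)`, with derivatives `f₁`, `f₂` that satisfy
the zeroth order symbol estimates `|s f₁| ≤ c f` and `|s² f₂| ≤ c f`. -/
structure IsSymbolWith (c : ℝ) (f f₁ f₂ : ℝ → ℝ) : Prop where
  pos : ∀ s, 0 ≤ s → 0 < f s
  hasDerivAt : ∀ s, 0 ≤ s → HasDerivAt f (f₁ s) s
  hasDerivAt_deriv : ∀ s, 0 ≤ s → HasDerivAt f₁ (f₂ s) s
  bound_deriv : ∀ s, 0 ≤ s → |s * f₁ s| ≤ c * f s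
  bound_deriv2 : ∀ s, 0 ≤ s → |s ^ 2 * f₂ s| ≤ c * f s

namespace IsSymbolWith

variable {c : ℝ} {f f₁ f₂ g g₁ g₂ : ℝ → ℝ}

theorem sqrt_one_add_mul {a : ℝ} (ha : 0 ≤ a) :
    IsSymbolWith 1 (fun s => √(1 + a * s)) (fun s => a / (2 * √(1 + a * s)))
      (fun s => -(a ^ 2 / (4 * √(1 + a * s) ^ 3))) := by
  have arg_pos : ∀ s, 0 ≤ s → 0 < 1 + a * s := fun s hs => by positivity
  have hder : ∀ s, 0 ≤ s → HasDerivAt (fun s => √(1 + a * s)) (a / (2 * √(1 + a * s))) s := by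
    intro s hs
    have h : HasDerivAt (fun s => 1 + a * s) a s := by
      simpa using ((hasDerivAt_id s).const_mul a).const_add 1
    exact h.sqrt (arg_pos s hs).ne'
  refine ⟨fun s hs => Real.sqrt_pos.2 (arg_pos s hs), hder, fun s hs => ?_, fun s hs => ?_,
    fun s hs => ?_⟩
  · have hp := Real.sqrt_pos.2 (arg_pos s hs)
    refine ((hasDerivAt_const s a).div ((hder s hs).const_mul 2) (by positivity)).congr_deriv ?_
    field_simp
    ring
  · have hp := Real.sqrt_pos.2 (arg_pos s hs)
    have hq := Real.sq_sqrt (arg_pos s hs).le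
    have has : 0 ≤ a * s := by positivity
    rw [abs_of_nonneg (by positivity), mul_div_assoc', div_le_iff₀ (by positivity)]
    nlinarith
  · have hp := Real.sqrt_pos.2 (arg_pos s hs)
    have hq := Real.sq_sqrt (arg_pos s hs).le
    have has : 0 ≤ a * s := by positivity
    rw [mul_neg, abs_neg, abs_of_nonneg (by positivity), mul_div_assoc',
      div_le_iff₀ (by positivity)]
    have h4 : √(1 + a * s) ^ 4 = (1 + a * s) ^ 2 := by
      calc √(1 + a * s) ^ 4 = (√(1 + a * s) ^ 2) ^ 2 := by ring
        _ = (1 + a * s) ^ 2 := by rw [hq]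
    have : 1 * √(1 + a * s) * (4 * √(1 + a * s) ^ 3) = 4 * (1 + a * s) ^ 2 := by
      rw [← h4]; ring
    rw [this]
    nlinarith

theorem add (hf : IsSymbolWith c f f₁ f₂) (hg : IsSymbolWith c g g₁ g₂) :
    IsSymbolWith c (fun s => f s + g s) (fun s => f₁ s + g₁ s) (fun s => f₂ s + g₂ s) where
  pos s hs := add_pos (hf.pos s hs) (hg.pos s hs)
  hasDerivAt s hs := (hf.hasDerivAt s hs).add (hg.hasDerivAt s hs)
  hasDerivAt_deriv s hs := (hf.hasDerivAt_deriv s hs).add (hg.hasDerivAt_deriv s hs)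
  bound_deriv s hs := by
    rw [mul_add, mul_add]
    exact (abs_add_le _ _).trans (add_le_add (hf.bound_deriv s hs) (hg.bound_deriv s hs))
  bound_deriv2 s hs := by
    rw [mul_add, mul_add]
    exact (abs_add_le _ _).trans (add_le_add (hf.bound_deriv2 s hs) (hg.bound_deriv2 s hs))

theorem mul (hf : IsSymbolWith c f f₁ f₂) (hg : IsSymbolWith c g g₁ g₂) :
    IsSymbolWith (2 * c + 2 * c ^ 2) (fun s => f s * g s) (fun s => f₁ s * g s + f s * g₁ s)
      (fun s => f₂ s * g s + f₁ s * g₁ s + (f₁ s * g₁ s + f s * g₂ s)) where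
  pos s hs := mul_pos (hf.pos s hs) (hg.pos s hs)
  hasDerivAt s hs := (hf.hasDerivAt s hs).mul (hg.hasDerivAt s hs)
  hasDerivAt_deriv s hs :=
    ((hf.hasDerivAt_deriv s hs).mul (hg.hasDerivAt s hs)).add
      ((hf.hasDerivAt s hs).mul (hg.hasDerivAt_deriv s hs))
  bound_deriv s hs := by
    have pf := hf.pos s hs
    have pg := hg.pos s hs
    calc |s * (f₁ s * g s + f s * g₁ s)| = |(s * f₁ s) * g s + f s * (s * g₁ s)| := by ring_nf
      _ ≤ |s * f₁ s| * g s + f s * |s * g₁ s| := by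
        refine (abs_add_le _ _).trans_eq ?_
        rw [abs_mul _ (g s), abs_mul (f s), abs_of_pos pf, abs_of_pos pg]
      _ ≤ (c * f s) * g s + f s * (c * g s) := by
        gcongr
        exacts [hf.bound_deriv s hs, hg.bound_deriv s hs]
      _ ≤ (2 * c + 2 * c ^ 2) * (f s * g s) := by
        have : 0 ≤ c ^ 2 * (f s * g s) := by positivity
        linarith
  bound_deriv2 s hs := by
    have pf := hf.pos s hs
    have pg := hg.pos s hs
    have hcf : 0 ≤ c * f s := (abs_nonneg _).trans (hf.bound_deriv s hs)
    calc |s ^ 2 * (f₂ s * g s + f₁ s * g₁ s + (f₁ s * g₁ s + f s * g₂ s))|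
        = |(s ^ 2 * f₂ s) * g s + 2 * ((s * f₁ s) * (s * g₁ s)) + f s * (s ^ 2 * g₂ s)| := by
          ring_nf
      _ ≤ |s ^ 2 * f₂ s| * g s + 2 * (|s * f₁ s| * |s * g₁ s|) + f s * |s ^ 2 * g₂ s| := by
        refine (abs_add_three _ _ _).trans_eq ?_
        rw [abs_mul _ (g s), abs_mul (f s), abs_mul 2, abs_mul (s * f₁ s), abs_of_pos pf,
          abs_of_pos pg, abs_two]
      _ ≤ (c * f s) * g s + 2 * ((c * f s) * (c * g s)) + f s * (c * g s) := by
        gcongr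
        exacts [hf.bound_deriv2 s hs, hf.bound_deriv s hs, hg.bound_deriv s hs,
          hg.bound_deriv2 s hs]
      _ = (2 * c + 2 * c ^ 2) * (f s * g s) := by ring

theorem inv (hf : IsSymbolWith c f f₁ f₂) :
    IsSymbolWith (c + 2 * c ^ 2) (fun s => (f s)⁻¹) (fun s => -f₁ s / f s ^ 2)
      (fun s => -f₂ s / f s ^ 2 + 2 * f₁ s ^ 2 / f s ^ 3) where
  pos s hs := inv_pos.2 (hf.pos s hs)
  hasDerivAt s hs := (hf.hasDerivAt s hs).fun_inv (hf.pos s hs).ne'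
  hasDerivAt_deriv s hs := by
    have pf := hf.pos s hs
    refine ((hf.hasDerivAt_deriv s hs).neg.div ((hf.hasDerivAt s hs).pow 2)
      (pow_ne_zero 2 pf.ne')).congr_deriv ?_
    simp
    field_simp
  bound_deriv s hs := by
    have pf := hf.pos s hs
    calc |s * (-f₁ s / f s ^ 2)| = |s * f₁ s| / f s ^ 2 := by
          rw [mul_div_assoc', mul_neg, abs_div, abs_neg, abs_of_pos (pow_pos pf 2)]
      _ ≤ (c * f s) / f s ^ 2 := by
        gcongr
        exact hf.bound_deriv s hs
      _ = c * (f s)⁻¹ := by field_simp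
      _ ≤ (c + 2 * c ^ 2) * (f s)⁻¹ := by
        gcongr
        nlinarith [sq_nonneg c]
  bound_deriv2 s hs := by
    have pf := hf.pos s hs
    calc |s ^ 2 * (-f₂ s / f s ^ 2 + 2 * f₁ s ^ 2 / f s ^ 3)|
        = |-((s ^ 2 * f₂ s) / f s ^ 2) + 2 * (s * f₁ s) ^ 2 / f s ^ 3| := by ring_nf
      _ ≤ |s ^ 2 * f₂ s| / f s ^ 2 + 2 * |s * f₁ s| ^ 2 / f s ^ 3 := by
        refine (abs_add_le _ _).trans_eq ?_
        rw [abs_neg, abs_div, abs_of_pos (pow_pos pf 2), sq_abs, abs_of_nonneg (by positivity :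
          0 ≤ 2 * (s * f₁ s) ^ 2 / f s ^ 3)]
      _ ≤ (c * f s) / f s ^ 2 + 2 * (c * f s) ^ 2 / f s ^ 3 := by
        gcongr
        exacts [hf.bound_deriv2 s hs, hf.bound_deriv s hs]
      _ = (c + 2 * c ^ 2) * (f s)⁻¹ := by field_simp

end IsSymbolWith

theorem hasFDerivAt_comp_norm_sq {E : Type*} [NormedAddCommGroup E] [InnerProductSpace ℝ E]
    {f : ℝ → ℝ} {f' : ℝ} {x : E} (hf : HasDerivAt f f' (‖x‖ ^ 2)) :
    HasFDerivAt (fun y : E => f (‖y‖ ^ 2)) (f' • (2 • innerSL ℝ x)) x :=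
  hf.comp_hasFDerivAt x (hasStrictFDerivAt_norm_sq x).hasFDerivAt

section Radial

variable {ι : Type*} [Fintype ι] [DecidableEq ι] {f f₁ f₂ : ℝ → ℝ}

theorem fderiv_comp_norm_sq_single (hf : ∀ s, 0 ≤ s → HasDerivAt f (f₁ s) s)
    (u : EuclideanSpace ℝ ι) (i : ι) :
    fderiv ℝ (fun v : EuclideanSpace ℝ ι => f (‖v‖ ^ 2)) u (EuclideanSpace.single i 1) =
      2 * u i * f₁ (‖u‖ ^ 2) := by
  rw [(hasFDerivAt_comp_norm_sq (hf _ (sq_nonneg ‖u‖))).fderiv]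
  simp [EuclideanSpace.inner_single_right]
  ring

theorem fderiv_fderiv_comp_norm_sq_single (hf : ∀ s, 0 ≤ s → HasDerivAt f (f₁ s) s)
    (hf₁ : ∀ s, 0 ≤ s → HasDerivAt f₁ (f₂ s) s) (u : EuclideanSpace ℝ ι) (i j : ι) :
    fderiv ℝ (fun v : EuclideanSpace ℝ ι =>
        fderiv ℝ (fun w : EuclideanSpace ℝ ι => f (‖w‖ ^ 2)) v (EuclideanSpace.single i 1)) u
        (EuclideanSpace.single j 1) =
      2 * (if i = j then 1 else 0) * f₁ (‖u‖ ^ 2) + 4 * (u i * u j) * f₂ (‖u‖ ^ 2) := by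
  simp only [fderiv_comp_norm_sq_single hf]
  have hi : HasFDerivAt (fun v : EuclideanSpace ℝ ι => 2 * v i)
      ((2 : ℝ) • (EuclideanSpace.proj i : EuclideanSpace ℝ ι →L[ℝ] ℝ)) u :=
    (EuclideanSpace.proj i : EuclideanSpace ℝ ι →L[ℝ] ℝ).hasFDerivAt.const_mul 2
  rw [(hi.fun_mul (hasFDerivAt_comp_norm_sq (hf₁ _ (sq_nonneg ‖u‖)))).fderiv]
  simp [EuclideanSpace.inner_single_right]
  split_ifs <;> ring

end Radial

/-- Uniform `C²` bounds for `g(u) = |u|²/((u⁰₁+u⁰₂)·u⁰₂)` where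
`u⁰ᵢ(u) = √(1+eᵢ²|u|²)`, with a constant depending only on `m`, uniformly
for `e₁, e₂ ≥ m`. -/
theorem ratio_usq_bounds (m : ℝ) (hm : 0 < m) :
    ∃ C : ℝ, 0 < C ∧
      ∀ e₁ e₂ : ℝ, m ≤ e₁ → m ≤ e₂ →
        ∀ (u : EuclideanSpace ℝ (Fin 3)) (i j : Fin 3),
          |‖u‖ ^ 2 / ((Real.sqrt (1 + e₁ ^ 2 * ‖u‖ ^ 2) + Real.sqrt (1 + e₂ ^ 2 * ‖u‖ ^ 2)) *
              Real.sqrt (1 + e₂ ^ 2 * ‖u‖ ^ 2))| ≤ C ∧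
          |fderiv ℝ (fun v : EuclideanSpace ℝ (Fin 3) =>
              ‖v‖ ^ 2 / ((Real.sqrt (1 + e₁ ^ 2 * ‖v‖ ^ 2) + Real.sqrt (1 + e₂ ^ 2 * ‖v‖ ^ 2)) *
                Real.sqrt (1 + e₂ ^ 2 * ‖v‖ ^ 2))) u (EuclideanSpace.single i 1)| ≤ C ∧
          |fderiv ℝ (fun v : EuclideanSpace ℝ (Fin 3) =>
              fderiv ℝ (fun w : EuclideanSpace ℝ (Fin 3) =>
                  ‖w‖ ^ 2 / ((Real.sqrt (1 + e₁ ^ 2 * ‖w‖ ^ 2) +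
                      Real.sqrt (1 + e₂ ^ 2 * ‖w‖ ^ 2)) *
                    Real.sqrt (1 + e₂ ^ 2 * ‖w‖ ^ 2))) v
                (EuclideanSpace.single i 1)) u (EuclideanSpace.single j 1)| ≤ C := by
  refine ⟨1 / m ^ 2 + 74 / m + 506, by positivity, fun e₁ e₂ _ he₂ u i j => ?_⟩
  set h : ℝ → ℝ := fun s =>
    ((√(1 + e₁ ^ 2 * s) + √(1 + e₂ ^ 2 * s)) * √(1 + e₂ ^ 2 * s))⁻¹ with h_def
  obtain ⟨h₁, h₂, hh⟩ : ∃ h₁ h₂, IsSymbolWith 36 h h₁ h₂ := by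
    have hA := IsSymbolWith.sqrt_one_add_mul (sq_nonneg e₁)
    have hB := IsSymbolWith.sqrt_one_add_mul (sq_nonneg e₂)
    have hAB := ((hA.add hB).mul hB).inv
    norm_num only at hAB
    exact ⟨_, _, hAB⟩
  have hF : ∀ s, 0 ≤ s → HasDerivAt (fun s => s * h s) (h s + s * h₁ s) s := fun s hs => by
    simpa using (hasDerivAt_id' s).fun_mul (hh.hasDerivAt s hs)
  have hF₁ : ∀ s, 0 ≤ s →
      HasDerivAt (fun s => h s + s * h₁ s) (h₁ s + (h₁ s + s * h₂ s)) s := fun s hs => by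
    simpa using (hh.hasDerivAt s hs).fun_add
      ((hasDerivAt_id' s).fun_mul (hh.hasDerivAt_deriv s hs))
  have hform : ∀ v : EuclideanSpace ℝ (Fin 3), ‖v‖ ^ 2 / ((√(1 + e₁ ^ 2 * ‖v‖ ^ 2) +
      √(1 + e₂ ^ 2 * ‖v‖ ^ 2)) * √(1 + e₂ ^ 2 * ‖v‖ ^ 2)) = ‖v‖ ^ 2 * h (‖v‖ ^ 2) :=
    fun v => div_eq_mul_inv _ _
  simp only [hform]
  rw [fderiv_fderiv_comp_norm_sq_single hF hF₁, fderiv_comp_norm_sq_single hF]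
  have hs : 0 ≤ ‖u‖ ^ 2 := sq_nonneg _
  have hpos := hh.pos _ hs
  have hb₁ := hh.bound_deriv _ hs
  have hb₂ := hh.bound_deriv2 _ hs
  have hsq : (1 + m ^ 2 * ‖u‖ ^ 2) * h (‖u‖ ^ 2) ≤ 1 := by
    have hB1 : 0 < 1 + e₂ ^ 2 * ‖u‖ ^ 2 := by positivity
    have hBB := Real.mul_self_sqrt hB1.le
    have hme : m ^ 2 * ‖u‖ ^ 2 ≤ e₂ ^ 2 * ‖u‖ ^ 2 := by gcongr
    have hD : 0 < (√(1 + e₁ ^ 2 * ‖u‖ ^ 2) + √(1 + e₂ ^ 2 * ‖u‖ ^ 2)) *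
        √(1 + e₂ ^ 2 * ‖u‖ ^ 2) := by positivity
    rw [h_def]
    refine (mul_inv_le_iff₀ hD).2 ?_
    have : 0 ≤ √(1 + e₁ ^ 2 * ‖u‖ ^ 2) * √(1 + e₂ ^ 2 * ‖u‖ ^ 2) := by positivity
    linarith
  have hle_one : h (‖u‖ ^ 2) ≤ 1 := by
    have : 0 ≤ m ^ 2 * ‖u‖ ^ 2 * h (‖u‖ ^ 2) := by positivity
    linarith
  have hsmul : ‖u‖ ^ 2 * h (‖u‖ ^ 2) ≤ 1 / m ^ 2 := by
    rw [le_div_iff₀ (by positivity)]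
    linarith
  have hnorm : ‖u‖ * h (‖u‖ ^ 2) ≤ 1 / m := by
    rw [le_div_iff₀ hm]
    have : m * ‖u‖ * h (‖u‖ ^ 2) ≤ (1 + m ^ 2 * ‖u‖ ^ 2) * h (‖u‖ ^ 2) := by
      gcongr
      nlinarith [sq_nonneg (m * ‖u‖ - 1), sq_nonneg (m * ‖u‖)]
    linarith
  have hF₁_le : |h (‖u‖ ^ 2) + ‖u‖ ^ 2 * h₁ (‖u‖ ^ 2)| ≤ 37 * h (‖u‖ ^ 2) := by
    refine (abs_add_le _ _).trans ?_
    rw [abs_of_pos hpos]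
    linarith
  have hF₂_le : ‖u‖ ^ 2 * |h₁ (‖u‖ ^ 2) + (h₁ (‖u‖ ^ 2) + ‖u‖ ^ 2 * h₂ (‖u‖ ^ 2))| ≤
      108 * h (‖u‖ ^ 2) := by
    calc ‖u‖ ^ 2 * |h₁ (‖u‖ ^ 2) + (h₁ (‖u‖ ^ 2) + ‖u‖ ^ 2 * h₂ (‖u‖ ^ 2))|
        = |‖u‖ ^ 2 * h₁ (‖u‖ ^ 2) + ‖u‖ ^ 2 * h₁ (‖u‖ ^ 2) +
            (‖u‖ ^ 2) ^ 2 * h₂ (‖u‖ ^ 2)| := by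
          rw [← abs_of_nonneg hs, ← abs_mul, abs_of_nonneg hs]
          ring_nf
      _ ≤ _ := (abs_add_three _ _ _).trans (by linarith)
  have hcoord : ∀ k, |u k| ≤ ‖u‖ := fun k => PiLp.norm_apply_le u k
  have hm1 : 0 < 1 / m := by positivity
  have hm2 : 0 < 1 / m ^ 2 := by positivity
  have hm74 : 74 / m = 74 * (1 / m) := by ring
  refine ⟨?_, ?_, ?_⟩
  · rw [abs_of_nonneg (by positivity)]
    linarith
  · calc |2 * u i * (h (‖u‖ ^ 2) + ‖u‖ ^ 2 * h₁ (‖u‖ ^ 2))|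
        = 2 * |u i| * |h (‖u‖ ^ 2) + ‖u‖ ^ 2 * h₁ (‖u‖ ^ 2)| := by
          rw [abs_mul, abs_mul, abs_two]
      _ ≤ 2 * ‖u‖ * (37 * h (‖u‖ ^ 2)) := by
        gcongr
        exact hcoord i
      _ ≤ _ := by linarith
  · have hdelta : |if i = j then (1 : ℝ) else 0| ≤ 1 := by split_ifs <;> simp
    refine (abs_add_le _ _).trans ?_
    rw [abs_mul, abs_mul, abs_mul (4 * _), abs_mul 4, abs_mul (u i), abs_two,
      abs_of_pos (four_pos : (0 : ℝ) < 4)]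
    calc
      _ ≤ 2 * 1 * (37 * h (‖u‖ ^ 2)) + 4 * (‖u‖ * ‖u‖) *
          |h₁ (‖u‖ ^ 2) + (h₁ (‖u‖ ^ 2) + ‖u‖ ^ 2 * h₂ (‖u‖ ^ 2))| := by
        gcongr
        exacts [hcoord i, hcoord j]
      _ ≤ _ := by linarith
end
end
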